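/- arXiv:1201.3504 — 2 statements merged into one kernel-verified Lean document; each statement's English description precedes it below -/
import Mathlib

section
/- Fix n ≥ 1 and k with 1 ≤ k ≤ 1+n, and let T be a natural 2-covariant tensor associated to a Lorentzian metric and a k-form on open subsets of ℝ^{1+n}. If T satisfies: (1) independence of the unit of scale, i.e. T(λ²g, λ^{k−1}ω) = T(g,ω) for every λ > 0; and (2) for every point x, ω_x = 0 implies T(g,ω)_x = 0; then there exist constants μ₁, μ₂ ∈ ℝ (independent of g and ω) such that T(g,ω) = μ₁ · ⟨i_−ω, i_−ω⟩_g + μ₂ · ⟨ω,ω⟩_g g. -/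
namespace Paper

noncomputable section

/-- Points of `ℝ^{1+n}`. -/
abbrev Pt (n : ℕ) := Fin (n + 1) → ℝ

/-- Partial derivative `∂_a f` of a scalar function. -/
def pd (n : ℕ) (a : Fin (n + 1)) (f : Pt n → ℝ) (x : Pt n) : ℝ :=
  fderiv ℝ f x (Pi.single a 1)

/-- The signs `ε₀ = 1`, `ε_i = -1` for `i ≠ 0`. -/
def eps (n : ℕ) (i : Fin (n + 1)) : ℝ := if i = 0 then 1 else -1

/-- The standard Minkowski matrix `diag(1, -1, …, -1)`. -/
def minkM (n : ℕ) (a b : Fin (n + 1)) : ℝ := if a = b then eps n a else 0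

/-- Prepend an entry to an index tuple: `(a, v₁, …, v_{k-1})`. -/
def dcons {α : Type*} (k : ℕ) (a : α) (v : Fin (k - 1) → α) : Fin k → α :=
  fun j => if h : (j : ℕ) = 0 then a else v ⟨(j : ℕ) - 1, by have := j.isLt; omega⟩

/-- Append an entry to an index tuple: `(v₁, …, v_{k-1}, b)`. -/
def dsnoc {α : Type*} (k : ℕ) (v : Fin (k - 1) → α) (b : α) : Fin k → α :=
  fun j => if h : (j : ℕ) < k - 1 then v ⟨(j : ℕ), h⟩ else b

/-- `g` (given by its components) is a Lorentzian metric on the open set `W`: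
it is smooth on `W` and, at each point of `W`, a symmetric bilinear form of
signature `(1,n)` (i.e. congruent to the Minkowski matrix). -/
def IsMetricOn (n : ℕ) (W : Set (Pt n)) (g : Pt n → Fin (n + 1) → Fin (n + 1) → ℝ) : Prop :=
  (∀ a b, ContDiffOn ℝ (⊤ : ℕ∞) (fun x => g x a b) W) ∧
  (∀ x ∈ W, (∀ a b, g x a b = g x b a) ∧
    ∃ P : Matrix (Fin (n + 1)) (Fin (n + 1)) ℝ, IsUnit P.det ∧
      ∀ a b, (∑ c, ∑ d, P c a * g x c d * P d b) = minkM n a b)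

/-- `ω` (given by its components) is a smooth `k`-form field on the open set `W`. -/
def IsFormOn (n k : ℕ) (W : Set (Pt n)) (ω : Pt n → (Fin k → Fin (n + 1)) → ℝ) : Prop :=
  (∀ v, ContDiffOn ℝ (⊤ : ℕ∞) (fun x => ω x v) W) ∧
  (∀ x ∈ W, ∀ (v : Fin k → Fin (n + 1)) (σ : Equiv.Perm (Fin k)),
    ω x (v ∘ σ) = ((Equiv.Perm.sign σ : ℤ) : ℝ) * ω x v)

/-- `t` is a smooth 2-covariant tensor field on `W`. -/
def IsTensorFieldOn (n : ℕ) (W : Set (Pt n)) (t : Pt n → Fin (n + 1) → Fin (n + 1) → ℝ) : Prop :=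
  ∀ a b, ContDiffOn ℝ (⊤ : ℕ∞) (fun x => t x a b) W

/-- `τ : W → W'` is a diffeomorphism between open subsets of `ℝ^{1+n}`, with inverse `σf`. -/
structure IsDiffeoOn (n : ℕ) (τ σf : Pt n → Pt n) (W W' : Set (Pt n)) : Prop where
  open_src : IsOpen W
  open_tgt : IsOpen W'
  mapsTo : Set.MapsTo τ W W'
  mapsTo_inv : Set.MapsTo σf W' W
  left_inv : ∀ x ∈ W, σf (τ x) = x
  right_inv : ∀ y ∈ W', τ (σf y) = y
  smooth : ContDiffOn ℝ (⊤ : ℕ∞) τ W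
  smooth_inv : ContDiffOn ℝ (⊤ : ℕ∞) σf W'

/-- The Jacobian matrix `(dτ_x)(e_a)_c` of a map `τ`. -/
def jac (n : ℕ) (τ : Pt n → Pt n) (x : Pt n) (a c : Fin (n + 1)) : ℝ :=
  fderiv ℝ τ x (Pi.single a 1) c

/-- Pullback of a 2-covariant tensor field (in particular of a metric):
`(τ*g)_x(u,v) = g_{τ(x)}(dτ_x u, dτ_x v)`, componentwise. -/
def pullTensor (n : ℕ) (τ : Pt n → Pt n) (g : Pt n → Fin (n + 1) → Fin (n + 1) → ℝ) :
    Pt n → Fin (n + 1) → Fin (n + 1) → ℝ :=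
  fun x a b => ∑ c, ∑ d, jac n τ x a c * jac n τ x b d * g (τ x) c d

/-- Pullback of a `k`-form field, componentwise. -/
def pullForm (n k : ℕ) (τ : Pt n → Pt n) (ω : Pt n → (Fin k → Fin (n + 1)) → ℝ) :
    Pt n → (Fin k → Fin (n + 1)) → ℝ :=
  fun x v => ∑ w : Fin k → Fin (n + 1), (∏ j, jac n τ x (v j) (w j)) * ω (τ x) w

/-- A natural 2-covariant tensor `T(g,ω)` associated to a Lorentzian metric and a `k`-form
on open subsets of `ℝ^{1+n}`: a rule assigning to every open `W` and every pair `(g,ω)` on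
`W` a 2-covariant tensor field `T(g,ω)` on `W` that commutes with restrictions, is
equivariant under diffeomorphisms between open subsets, and is regular (smooth families of
data yield smooth families of values). -/
structure NaturalTensor (n k : ℕ) where
  T : Set (Pt n) → (Pt n → Fin (n + 1) → Fin (n + 1) → ℝ) →
      (Pt n → (Fin k → Fin (n + 1)) → ℝ) → (Pt n → Fin (n + 1) → Fin (n + 1) → ℝ)
  smooth : ∀ W g ω, IsOpen W → IsMetricOn n W g → IsFormOn n k W ω →
      IsTensorFieldOn n W (T W g ω)
  localize : ∀ W₁ W₂ g₁ ω₁ g₂ ω₂, IsOpen W₁ → IsOpen W₂ → W₁ ⊆ W₂ →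
      IsMetricOn n W₁ g₁ → IsFormOn n k W₁ ω₁ →
      IsMetricOn n W₂ g₂ → IsFormOn n k W₂ ω₂ →
      (∀ x ∈ W₁, g₁ x = g₂ x ∧ ω₁ x = ω₂ x) →
      ∀ x ∈ W₁, T W₁ g₁ ω₁ x = T W₂ g₂ ω₂ x
  natural : ∀ τ σf W W', IsDiffeoOn n τ σf W W' →
      ∀ g ω, IsMetricOn n W' g → IsFormOn n k W' ω →
      ∀ x ∈ W, ∀ a b, T W (pullTensor n τ g) (pullForm n k τ ω) x a b =
        pullTensor n τ (T W' g ω) x a b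
  regular : ∀ (m : ℕ) (P : Set (Fin m → ℝ)) (W : Set (Pt n)), IsOpen P → IsOpen W →
      ∀ (g : (Fin m → ℝ) → Pt n → Fin (n + 1) → Fin (n + 1) → ℝ)
        (ω : (Fin m → ℝ) → Pt n → (Fin k → Fin (n + 1)) → ℝ),
      (∀ a b, ContDiffOn ℝ (⊤ : ℕ∞)
        (fun p : (Fin m → ℝ) × Pt n => g p.1 p.2 a b) (P ×ˢ W)) →
      (∀ v, ContDiffOn ℝ (⊤ : ℕ∞)
        (fun p : (Fin m → ℝ) × Pt n => ω p.1 p.2 v) (P ×ˢ W)) →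
      (∀ s ∈ P, IsMetricOn n W (g s) ∧ IsFormOn n k W (ω s)) →
      ∀ a b, ContDiffOn ℝ (⊤ : ℕ∞)
        (fun p : (Fin m → ℝ) × Pt n => T W (g p.1) (ω p.1) p.2 a b) (P ×ˢ W)

/-- The inverse metric `g^{ab}` at a point. -/
def ginv (n : ℕ) (g : Pt n → Fin (n + 1) → Fin (n + 1) → ℝ) (x : Pt n) :
    Matrix (Fin (n + 1)) (Fin (n + 1)) ℝ :=
  (Matrix.of fun a b => g x a b)⁻¹

/-- The Christoffel symbols
`Γ^c_{ab} = (1/2) g^{cd}(∂_a g_{db} + ∂_b g_{da} − ∂_d g_{ab})`. -/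
def christoffel (n : ℕ) (g : Pt n → Fin (n + 1) → Fin (n + 1) → ℝ) (x : Pt n)
    (c a b : Fin (n + 1)) : ℝ :=
  (1 / 2) * ∑ d, ginv n g x c d *
    (pd n a (fun y => g y d b) x + pd n b (fun y => g y d a) x - pd n d (fun y => g y a b) x)

/-- The divergence of a 2-covariant tensor field: `(div_g t)_b = g^{ac} ∇_a t_{cb}`. -/
def divT (n : ℕ) (g t : Pt n → Fin (n + 1) → Fin (n + 1) → ℝ) (x : Pt n)
    (b : Fin (n + 1)) : ℝ :=
  ∑ a, ∑ c, ginv n g x a c *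
    (pd n a (fun y => t y c b) x - (∑ e, christoffel n g x e a c * t x e b)
      - (∑ e, christoffel n g x e a b * t x c e))

/-- The covariant derivative `∇_a ω_{v₁…v_k}` of a `k`-form field. -/
def covd (n k : ℕ) (g : Pt n → Fin (n + 1) → Fin (n + 1) → ℝ)
    (ω : Pt n → (Fin k → Fin (n + 1)) → ℝ) (x : Pt n) (a : Fin (n + 1))
    (v : Fin k → Fin (n + 1)) : ℝ :=
  pd n a (fun y => ω y v) x -
    ∑ l : Fin k, ∑ e, christoffel n g x e a (v l) * ω x (Function.update v l e)

/-- The codifferential `(∂_g ω)_{i₁…i_{k−1}} = −g^{ab} ∇_a ω_{b i₁…i_{k−1}}`. -/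
def codiff (n k : ℕ) (g : Pt n → Fin (n + 1) → Fin (n + 1) → ℝ)
    (ω : Pt n → (Fin k → Fin (n + 1)) → ℝ) (x : Pt n)
    (v : Fin (k - 1) → Fin (n + 1)) : ℝ :=
  -∑ a, ∑ b, ginv n g x a b * covd n k g ω x a (dcons k b v)

/-- The exterior differential `(dω)_{i₀…i_k} = Σ_j (−1)^j ∂_{i_j} ω_{i₀…î_j…i_k}`. -/
def dext (n k : ℕ) (ω : Pt n → (Fin k → Fin (n + 1)) → ℝ) (x : Pt n)
    (u : Fin (k + 1) → Fin (n + 1)) : ℝ :=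
  ∑ j : Fin (k + 1), (-1 : ℝ) ^ (j : ℕ) * pd n (u j) (fun y => ω y (u ∘ j.succAbove)) x

/-- `(i_{∂_g ω} ω)_b = (1/(k−1)!) (∂_g ω)^{i₂…i_k} ω_{i₂…i_k b}`, indices raised with `g`. -/
def iCodiff (n k : ℕ) (g : Pt n → Fin (n + 1) → Fin (n + 1) → ℝ)
    (ω : Pt n → (Fin k → Fin (n + 1)) → ℝ) (x : Pt n) (b : Fin (n + 1)) : ℝ :=
  (1 / ((k - 1).factorial : ℝ)) *
    ∑ v : Fin (k - 1) → Fin (n + 1), ∑ w : Fin (k - 1) → Fin (n + 1),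
      (∏ j, ginv n g x (v j) (w j)) * codiff n k g ω x v * ω x (dsnoc k w b)

/-- The scalar product `⟨ω,ω⟩_g = (1/k!) ω^{i₁…i_k} ω_{i₁…i_k}`, indices raised with `g`. -/
def scalarSq (n k : ℕ) (g : Pt n → Fin (n + 1) → Fin (n + 1) → ℝ)
    (ω : Pt n → (Fin k → Fin (n + 1)) → ℝ) (x : Pt n) : ℝ :=
  (1 / (k.factorial : ℝ)) * ∑ v : Fin k → Fin (n + 1), ∑ w : Fin k → Fin (n + 1),
    (∏ j, ginv n g x (v j) (w j)) * ω x v * ω x w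

/-- The components of the 2-covariant tensor `⟨i_−ω, i_−ω⟩_g`:
`(1/(k−1)!) ω_a{}^{i₂…i_k} ω_{b i₂…i_k}`, indices raised with `g`. -/
def iiInner (n k : ℕ) (g : Pt n → Fin (n + 1) → Fin (n + 1) → ℝ)
    (ω : Pt n → (Fin k → Fin (n + 1)) → ℝ) (x : Pt n) (a b : Fin (n + 1)) : ℝ :=
  (1 / ((k - 1).factorial : ℝ)) *
    ∑ v : Fin (k - 1) → Fin (n + 1), ∑ w : Fin (k - 1) → Fin (n + 1),
      (∏ j, ginv n g x (v j) (w j)) * ω x (dcons k a v) * ω x (dcons k b w)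

/-- The energy tensor `E(g,ω) = (−1)^{k−1}(⟨i_−ω,i_−ω⟩_g − (1/2)⟨ω,ω⟩_g g)`. -/
def energyTensor (n k : ℕ) (g : Pt n → Fin (n + 1) → Fin (n + 1) → ℝ)
    (ω : Pt n → (Fin k → Fin (n + 1)) → ℝ) (x : Pt n) (a b : Fin (n + 1)) : ℝ :=
  (-1 : ℝ) ^ (k - 1) *
    (iiInner n k g ω x a b - (1 / 2) * scalarSq n k g ω x * g x a b)

/-- The Ricci tensor
`Ricci_{ab} = ∂_c Γ^c_{ab} − ∂_a Γ^c_{cb} + Γ^c_{cd} Γ^d_{ab} − Γ^c_{ad} Γ^d_{cb}`. -/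
def ricci (n : ℕ) (g : Pt n → Fin (n + 1) → Fin (n + 1) → ℝ) (x : Pt n)
    (a b : Fin (n + 1)) : ℝ :=
  (∑ c, pd n c (fun y => christoffel n g y c a b) x)
  - (∑ c, pd n a (fun y => christoffel n g y c c b) x)
  + (∑ c, ∑ d, christoffel n g x c c d * christoffel n g x d a b)
  - (∑ c, ∑ d, christoffel n g x c a d * christoffel n g x d c b)

/-- The scalar curvature `r(g) = g^{ab} Ricci_{ab}`. -/
def scalarCurv (n : ℕ) (g : Pt n → Fin (n + 1) → Fin (n + 1) → ℝ) (x : Pt n) : ℝ :=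
  ∑ a, ∑ b, ginv n g x a b * ricci n g x a b

end

end Paper

namespace Paper

open scoped Topology

lemma two_mul_eq_of_homogeneous {E : Type*} [NormedAddCommGroup E] [NormedSpace ℝ E] (f : E → ℝ)
    (hf : ContDiffAt ℝ 2 f 0) (x : E)
    (hx : ∀ t : ℝ, 0 < t → t ≤ 1 → f (t • x) = t ^ 2 * f x) :
    2 * f x = fderiv ℝ (fderiv ℝ f) 0 x x := by
  have h1 : ContDiffAt ℝ 1 (fderiv ℝ f) 0 := hf.fderiv_right (by norm_num)
  have hdiff : ∀ᶠ y in nhds (0 : E), DifferentiableAt ℝ f y := by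
    filter_upwards [hf.eventually (by simp)] with y hy
    exact hy.differentiableAt (by norm_num)
  have hline : Filter.Tendsto (fun t : ℝ => t • x) (nhds 0) (nhds 0) := by
    have : Continuous (fun t : ℝ => t • x) := by fun_prop
    simpa using this.tendsto 0
  have hderiv : ∀ᶠ t in nhdsWithin (0 : ℝ) (Set.Ioi 0), fderiv ℝ f (t • x) x = 2 * t * f x := by
    have h2 : ∀ᶠ t in nhdsWithin (0 : ℝ) (Set.Ioi 0), DifferentiableAt ℝ f (t • x) :=
      (hline.eventually hdiff).filter_mono nhdsWithin_le_nhds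
    filter_upwards [h2, Ioo_mem_nhdsGT (show (0 : ℝ) < 1 by norm_num)] with t ht ht1
    have e1 : HasDerivAt (fun s : ℝ => f (s • x)) (fderiv ℝ f (t • x) x) t := by
      have h3 : HasDerivAt (fun s : ℝ => s • x) x t := by
        simpa using (hasDerivAt_id t).smul_const x
      exact ht.hasFDerivAt.comp_hasDerivAt t h3
    have e2 : HasDerivAt (fun s : ℝ => f (s • x)) (2 * t * f x) t := by
      have : HasDerivAt (fun s : ℝ => s ^ 2 * f x) (2 * t * f x) t := by
        simpa using (hasDerivAt_pow 2 t).mul_const (f x)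
      refine this.congr_of_eventuallyEq ?_
      filter_upwards [Ioo_mem_nhds ht1.1 ht1.2] with s hs
      exact hx s hs.1 hs.2.le
    exact e1.unique e2
  have hG : HasDerivAt (fun t : ℝ => fderiv ℝ f (t • x) x) (fderiv ℝ (fderiv ℝ f) 0 x x) 0 := by
    have hd : HasFDerivAt (fderiv ℝ f) (fderiv ℝ (fderiv ℝ f) 0) ((0 : ℝ) • x) := by
      rw [zero_smul]
      exact (h1.differentiableAt (by norm_num)).hasFDerivAt
    have h3 : HasDerivAt (fun s : ℝ => s • x) x 0 := by
      simpa using (hasDerivAt_id (0 : ℝ)).smul_const x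
    have h4 : HasDerivAt (fun s : ℝ => fderiv ℝ f (s • x)) (fderiv ℝ (fderiv ℝ f) 0 x) 0 :=
      hd.comp_hasDerivAt (0 : ℝ) h3
    exact (ContinuousLinearMap.apply ℝ ℝ x).hasFDerivAt.comp_hasDerivAt (0 : ℝ) h4
  have h0 : fderiv ℝ f ((0 : ℝ) • x) x = 0 := by
    have l1 := hG.continuousAt.tendsto.mono_left (nhdsWithin_le_nhds (s := Set.Ioi 0))
    have l2 : Filter.Tendsto (fun t : ℝ => 2 * t * f x) (nhdsWithin 0 (Set.Ioi 0)) (nhds 0) := by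
      have : Continuous (fun t : ℝ => 2 * t * f x) := by fun_prop
      simpa using (this.tendsto 0).mono_left (nhdsWithin_le_nhds (s := Set.Ioi 0))
    exact tendsto_nhds_unique (l1.congr' hderiv) l2
  have l1 := hasDerivWithinAt_iff_tendsto_slope.1 (hG.hasDerivWithinAt (s := Set.Ioi 0))
  have l2 : Filter.Tendsto (slope (fun t : ℝ => fderiv ℝ f (t • x) x) 0)
      (nhdsWithin 0 (Set.Ioi 0)) (nhds (2 * f x)) := by
    refine tendsto_const_nhds.congr' ?_
    filter_upwards [hderiv, self_mem_nhdsWithin] with t ht ht0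
    have : t ≠ 0 := ne_of_gt ht0
    rw [slope_def_field, ht, h0]
    field_simp
    ring
  rw [Set.sdiff_singleton_eq_self (by simp)] at l1
  exact tendsto_nhds_unique l2 l1

open MeasureTheory in
lemma exists_hadamard {N : ℕ} (h : (Fin N → ℝ) → ℝ) (hh : ContDiff ℝ (⊤ : ℕ∞) h) :
    ∃ κ : Fin N → (Fin N → ℝ) → ℝ, (∀ i, ContDiff ℝ (⊤ : ℕ∞) (κ i)) ∧
      (∀ x, h x = h 0 + ∑ i, x i * κ i x) ∧ ∀ i, κ i 0 = fderiv ℝ h 0 (Pi.single i 1) := by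
  have hd : ∀ i, ContDiff ℝ (⊤ : ℕ∞) (fun y => fderiv ℝ h y (Pi.single i 1)) := fun i =>
    (hh.fderiv_right (m := (⊤ : ℕ∞)) (by simp)).clm_apply contDiff_const
  have hint : ∀ i x, IntervalIntegrable (fun t : ℝ => fderiv ℝ h (t • x) (Pi.single i 1))
      volume 0 1 := fun i x => by
    apply Continuous.intervalIntegrable
    exact (hd i).continuous.comp (by fun_prop)
  refine ⟨fun i x => ∫ t in (0 : ℝ)..1, fderiv ℝ h (t • x) (Pi.single i 1),
    fun i => ?_, fun x => ?_,
    fun i => by simp⟩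
  · let χ : ContDiffBump (0 : ℝ) := ⟨1, 2, by norm_num, by norm_num⟩
    let G : (Fin N → ℝ) → ℝ → ℝ := fun x s => χ s * fderiv ℝ h ((-s) • x) (Pi.single i 1)
    have hG : ContDiffOn ℝ (⊤ : ℕ∞) (Function.uncurry G) (Set.univ ×ˢ Set.univ) := by
      apply ContDiff.contDiffOn
      refine ContDiff.mul (χ.contDiff.comp contDiff_snd) ((hd i).comp ?_)
      exact contDiff_snd.neg.smul contDiff_fst
    have hf : LocallyIntegrable (Set.indicator (Set.Ioc (0 : ℝ) 1) (fun _ => (1 : ℝ))) volume := by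
      refine Integrable.locallyIntegrable ?_
      rw [integrable_indicator_iff measurableSet_Ioc]
      exact integrableOn_const (by simp)
    have key := contDiffOn_convolution_right_with_param (n := (⊤ : ℕ∞)) (μ := volume)
      (ContinuousLinearMap.mul ℝ ℝ) (g := G) isOpen_univ
      (isCompact_closedBall (0 : ℝ) 2) (fun p x _ hx => by
        have : χ x = 0 := χ.zero_of_le_dist (by
          simp only [Metric.mem_closedBall, not_le] at hx
          exact hx.le)
        simp [G, this]) hf hG
    rw [Set.univ_prod_univ, contDiffOn_univ] at key
    have key2 := key.comp (contDiff_id.prodMk (contDiff_const (c := (0 : ℝ))))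
    convert key2 using 1
    funext x
    simp only [Function.comp, convolution_def, id]
    rw [intervalIntegral.integral_of_le zero_le_one, ← integral_indicator measurableSet_Ioc]
    congr 1
    funext t
    by_cases ht : t ∈ Set.Ioc (0 : ℝ) 1
    · have : χ (-t) = 1 := χ.one_of_mem_closedBall (by
        simp only [Metric.mem_closedBall, dist_zero_right, norm_neg, Real.norm_eq_abs]
        rw [abs_of_pos ht.1]; exact ht.2)
      simp [ht, G, this]
    · simp [ht]
  · have hder : ∀ t : ℝ, HasDerivAt (fun s : ℝ => h (s • x))
        (∑ i, x i * fderiv ℝ h (t • x) (Pi.single i 1)) t := fun t => by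
      have h3 : HasDerivAt (fun s : ℝ => s • x) x t := by
        simpa using (hasDerivAt_id t).smul_const x
      have h4 : fderiv ℝ h (t • x) x = ∑ i, x i * fderiv ℝ h (t • x) (Pi.single i 1) := by
        conv_lhs => arg 2; rw [pi_eq_sum_univ' x]
        simp [map_sum]
      rw [← h4]
      exact ((hh.differentiable (by simp)) (t • x)).hasFDerivAt.comp_hasDerivAt t h3
    have h2 := intervalIntegral.integral_eq_sub_of_hasDerivAt (a := 0) (b := 1)
      (fun t _ => hder t) (by
        apply Continuous.intervalIntegrable
        refine continuous_finsetSum _ fun i _ => continuous_const.mul ?_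
        exact (hd i).continuous.comp (by fun_prop))
    rw [intervalIntegral.integral_finsetSum (fun i _ => (hint i x).const_mul _)] at h2
    simp only [intervalIntegral.integral_const_mul, one_smul, zero_smul] at h2
    linarith

lemma exists_hadamard_of_contDiffOn {N : ℕ} {U : Set (Fin N → ℝ)} (hU : IsOpen U) (h0 : 0 ∈ U)
    (h : (Fin N → ℝ) → ℝ) (hh : ContDiffOn ℝ (⊤ : ℕ∞) h U) :
    ∃ κ : Fin N → (Fin N → ℝ) → ℝ, (∀ i, ContDiff ℝ (⊤ : ℕ∞) (κ i)) ∧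
      (∀ᶠ x in nhds 0, h x = h 0 + ∑ i, x i * κ i x) ∧
      ∀ i, κ i 0 = fderiv ℝ h 0 (Pi.single i 1) := by
  obtain ⟨r, hr, hrU⟩ := Metric.isOpen_iff.1 hU 0 h0
  let χ : ContDiffBump (0 : Fin N → ℝ) := ⟨r / 4, r / 2, by positivity, by linarith⟩
  have hloc : (fun x => χ x * h x) =ᶠ[nhds 0] h := by
    filter_upwards [χ.eventuallyEq_one] with x hx
    simp [hx]
  have hs : ContDiff ℝ (⊤ : ℕ∞) (fun x => χ x * h x) := by
    rw [contDiff_iff_contDiffAt]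
    intro x
    by_cases hx : x ∈ Metric.ball (0 : Fin N → ℝ) r
    · exact χ.contDiffAt.mul (hh.contDiffAt (hU.mem_nhds (hrU hx)))
    · have : ∀ᶠ y in nhds x, χ y * h y = 0 := by
        have hm : (Metric.closedBall (0 : Fin N → ℝ) (r / 2))ᶜ ∈ nhds x := by
          refine Metric.isClosed_closedBall.isOpen_compl.mem_nhds ?_
          simp only [Metric.mem_ball, not_lt, Set.mem_compl_iff, Metric.mem_closedBall, not_le] at *
          linarith
        filter_upwards [hm] with y hy
        have : χ y = 0 := χ.zero_of_le_dist (by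
          simp only [Set.mem_compl_iff, Metric.mem_closedBall, not_le] at hy
          exact hy.le)
        simp [this]
      exact (contDiffAt_const (c := (0 : ℝ))).congr_of_eventuallyEq this
  obtain ⟨κ, k1, k2, k3⟩ := exists_hadamard _ hs
  refine ⟨κ, k1, ?_, fun i => by rw [k3, hloc.fderiv_eq]⟩
  filter_upwards [hloc] with x hx
  have h1 : χ 0 * h 0 = h 0 := hloc.self_of_nhds
  rw [← hx, k2 x, h1]

/-- The pullback of a bilinear form by a linear map, in components. -/
def pullB {n : ℕ} (M : Matrix (Fin (n + 1)) (Fin (n + 1)) ℝ)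
    (G : Fin (n + 1) → Fin (n + 1) → ℝ) : Fin (n + 1) → Fin (n + 1) → ℝ :=
  fun a b => ∑ c, ∑ d, M a c * M b d * G c d

/-- The pullback of a covariant `k`-tensor by a linear map, in components. -/
def pullF {n k : ℕ} (M : Matrix (Fin (n + 1)) (Fin (n + 1)) ℝ)
    (w : (Fin k → Fin (n + 1)) → ℝ) : (Fin k → Fin (n + 1)) → ℝ :=
  fun v => ∑ u : Fin k → Fin (n + 1), (∏ j, M (v j) (u j)) * w u

/-- A bilinear form of Lorentzian signature. -/
def IsLor {n : ℕ} (G : Fin (n + 1) → Fin (n + 1) → ℝ) : Prop :=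
  (∀ a b, G a b = G b a) ∧
    ∃ P : Matrix (Fin (n + 1)) (Fin (n + 1)) ℝ, IsUnit P.det ∧
      ∀ a b, (∑ c, ∑ d, P c a * G c d * P d b) = minkM n a b

/-- An alternating form, in components. -/
def IsAlt {n k : ℕ} (w : (Fin k → Fin (n + 1)) → ℝ) : Prop :=
  ∀ (v : Fin k → Fin (n + 1)) (σ : Equiv.Perm (Fin k)),
    w (v ∘ σ) = ((Equiv.Perm.sign σ : ℤ) : ℝ) * w v

lemma pullB_eq_mul {n : ℕ} (M : Matrix (Fin (n + 1)) (Fin (n + 1)) ℝ)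
    (G : Fin (n + 1) → Fin (n + 1) → ℝ) :
    (Matrix.of (pullB M G) : Matrix _ _ ℝ) = M * Matrix.of G * M.transpose := by
  ext a b
  simp only [pullB, Matrix.of_apply, Matrix.mul_apply, Matrix.transpose_apply, Finset.sum_mul]
  rw [Finset.sum_comm]
  exact Finset.sum_congr rfl fun _ _ => Finset.sum_congr rfl fun _ _ => by ring

lemma pullB_pullB {n : ℕ} (M M' : Matrix (Fin (n + 1)) (Fin (n + 1)) ℝ)
    (G : Fin (n + 1) → Fin (n + 1) → ℝ) : pullB M (pullB M' G) = pullB (M * M') G := by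
  apply Matrix.of.injective
  simp only [pullB_eq_mul, Matrix.transpose_mul, Matrix.mul_assoc]

lemma pullB_one {n : ℕ} (G : Fin (n + 1) → Fin (n + 1) → ℝ) : pullB 1 G = G := by
  apply Matrix.of.injective
  simp [pullB_eq_mul]

lemma pullF_pullF {n k : ℕ} (M M' : Matrix (Fin (n + 1)) (Fin (n + 1)) ℝ)
    (w : (Fin k → Fin (n + 1)) → ℝ) : pullF M (pullF M' w) = pullF (M * M') w := by
  funext v
  simp only [pullF, Finset.mul_sum, Matrix.mul_apply]
  rw [Finset.sum_comm]
  refine Finset.sum_congr rfl fun u _ => ?_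
  rw [Finset.prod_univ_sum, Finset.sum_mul, Fintype.piFinset_univ]
  refine Finset.sum_congr rfl fun x _ => ?_
  rw [Finset.prod_mul_distrib]
  ring

lemma pullF_smul_matrix {n k : ℕ} (t : ℝ) (w : (Fin k → Fin (n + 1)) → ℝ) :
    pullF (t • (1 : Matrix (Fin (n + 1)) (Fin (n + 1)) ℝ)) w = fun v => t ^ k * w v := by
  funext v
  rw [pullF, Finset.sum_eq_single v]
  · simp
  · intro u _ hu
    obtain ⟨j, hj⟩ := Function.ne_iff.1 hu
    rw [Finset.prod_eq_zero (Finset.mem_univ j), zero_mul]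
    simp [Matrix.one_apply_ne hj.symm]
  · simp

lemma pullF_one {n k : ℕ} (w : (Fin k → Fin (n + 1)) → ℝ) :
    pullF (1 : Matrix (Fin (n + 1)) (Fin (n + 1)) ℝ) w = w := by
  simpa using pullF_smul_matrix (n := n) 1 w

lemma isLor_iff {n : ℕ} (G : Fin (n + 1) → Fin (n + 1) → ℝ) :
    IsLor G ↔ (∀ a b, G a b = G b a) ∧
      ∃ M : Matrix (Fin (n + 1)) (Fin (n + 1)) ℝ, IsUnit M.det ∧ pullB M G = minkM n := by
  refine and_congr_right fun _ => ⟨?_, ?_⟩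
  · rintro ⟨P, hP, h⟩
    refine ⟨P.transpose, by rwa [Matrix.det_transpose], ?_⟩
    funext a b
    rw [← h a b]
    exact Finset.sum_congr rfl fun _ _ => Finset.sum_congr rfl fun _ _ => by
      simp only [Matrix.transpose_apply]; ring
  · rintro ⟨M, hM, h⟩
    refine ⟨M.transpose, by rwa [Matrix.det_transpose], fun a b => ?_⟩
    rw [← h]
    exact Finset.sum_congr rfl fun _ _ => Finset.sum_congr rfl fun _ _ => by
      simp only [Matrix.transpose_apply]; ring

lemma pullB_symm {n : ℕ} (M : Matrix (Fin (n + 1)) (Fin (n + 1)) ℝ)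
    {G : Fin (n + 1) → Fin (n + 1) → ℝ} (hG : ∀ a b, G a b = G b a) (a b : Fin (n + 1)) :
    pullB M G a b = pullB M G b a := by
  simp only [pullB]
  rw [Finset.sum_comm]
  exact Finset.sum_congr rfl fun c _ => Finset.sum_congr rfl fun d _ => by rw [hG d c]; ring

lemma IsLor.pullB {n : ℕ} {G : Fin (n + 1) → Fin (n + 1) → ℝ} (hG : IsLor G)
    {M : Matrix (Fin (n + 1)) (Fin (n + 1)) ℝ} (hM : IsUnit M.det) : IsLor (pullB M G) := by
  obtain ⟨h1, A, hA, h2⟩ := (isLor_iff G).1 hG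
  refine (isLor_iff _).2 ⟨pullB_symm M h1, A * M⁻¹, ?_, ?_⟩
  · rw [Matrix.det_mul]
    exact hA.mul (Matrix.isUnit_nonsing_inv_det _ hM)
  · rw [pullB_pullB, Matrix.mul_assoc, Matrix.nonsing_inv_mul _ hM, Matrix.mul_one, h2]

lemma isLor_minkM (n : ℕ) : IsLor (minkM n) := by
  refine (isLor_iff _).2 ⟨fun a b => ?_, 1, by simp, pullB_one _⟩
  simp only [minkM]
  by_cases h : a = b
  · simp [h]
  · simp [h, Ne.symm h]

lemma eps_mul_self (n : ℕ) (a : Fin (n + 1)) : eps n a * eps n a = 1 := by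
  unfold eps; split_ifs <;> norm_num

lemma eps_ne_zero (n : ℕ) (a : Fin (n + 1)) : eps n a ≠ 0 := by
  unfold eps; split_ifs <;> norm_num

lemma of_minkM (n : ℕ) : (Matrix.of (minkM n) : Matrix _ _ ℝ) = Matrix.diagonal (eps n) := by
  ext a b
  simp [minkM, Matrix.diagonal_apply]

lemma minkM_mul_self (n : ℕ) :
    (Matrix.of (minkM n) : Matrix _ _ ℝ) * Matrix.of (minkM n) = 1 := by
  rw [of_minkM, Matrix.diagonal_mul_diagonal]
  simp [eps_mul_self]

lemma IsLor.isUnit_det {n : ℕ} {G : Fin (n + 1) → Fin (n + 1) → ℝ} (hG : IsLor G) :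
    IsUnit (Matrix.of G : Matrix _ _ ℝ).det := by
  obtain ⟨-, M, hM, h⟩ := (isLor_iff G).1 hG
  have h1 : (Matrix.of (Paper.pullB M G) : Matrix _ _ ℝ).det = (Matrix.of (minkM n)).det := by rw [h]
  rw [pullB_eq_mul, Matrix.det_mul, Matrix.det_mul, Matrix.det_transpose] at h1
  have h2 : (Matrix.of (minkM n) : Matrix _ _ ℝ).det ≠ 0 := by
    intro h0
    have := congrArg Matrix.det (minkM_mul_self n)
    rw [Matrix.det_mul, h0] at this
    simp at this
  rw [← h1] at h2
  rw [isUnit_iff_ne_zero]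
  intro h3
  simp [h3] at h2

lemma IsAlt.pullF {n k : ℕ} {w : (Fin k → Fin (n + 1)) → ℝ} (hw : IsAlt w)
    (M : Matrix (Fin (n + 1)) (Fin (n + 1)) ℝ) : IsAlt (pullF M w) := by
  intro v σ
  simp only [Paper.pullF, Finset.mul_sum]
  refine Fintype.sum_equiv (σ.symm.arrowCongr (Equiv.refl _)).symm _ _ fun u => ?_
  have h1 : (σ.symm.arrowCongr (Equiv.refl _)).symm u = u ∘ σ.symm := by
    funext i; simp [Equiv.arrowCongr]
  have h2 : w u = ((Equiv.Perm.sign σ : ℤ) : ℝ) * w (u ∘ σ.symm) := by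
    rw [← hw]
    congr 1
    funext i; simp
  rw [h1, h2, ← Equiv.prod_comp σ (fun j => M (v j) ((u ∘ σ.symm) j))]
  simp only [Function.comp, Equiv.symm_apply_apply]
  ring

lemma IsAlt.smul {n k : ℕ} {w : (Fin k → Fin (n + 1)) → ℝ} (hw : IsAlt w) (t : ℝ) :
    IsAlt (fun v => t * w v) := fun v σ => by
  simp only [hw v σ]; ring

lemma IsAlt.add {n k : ℕ} {w w' : (Fin k → Fin (n + 1)) → ℝ} (hw : IsAlt w) (hw' : IsAlt w') :
    IsAlt (fun v => w v + w' v) := fun v σ => by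
  simp only [hw v σ, hw' v σ]; ring

lemma eventually_isLor_minkM (n : ℕ) :
    ∀ᶠ H in nhds (minkM n), (∀ a b, H a b = H b a) → IsLor H := by
  let Φ : (Fin (n + 1) → Fin (n + 1) → ℝ) → Fin (n + 1) → Fin (n + 1) → ℝ :=
    fun Y a b => ∑ c, Y a c * eps n c * Y c b
  let e : (Fin (n + 1) → Fin (n + 1) → ℝ) ≃L[ℝ] (Fin (n + 1) → Fin (n + 1) → ℝ) :=
    ContinuousLinearEquiv.smulLeft (Units.mk0 (2 : ℝ) two_ne_zero)
  have he : ∀ H, e H = (2 : ℝ) • H := fun H => rfl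
  have hΦ : HasStrictFDerivAt Φ (e : (Fin (n + 1) → Fin (n + 1) → ℝ) →L[ℝ] _) (minkM n) := by
    rw [hasStrictFDerivAt_pi']
    intro a
    rw [hasStrictFDerivAt_pi']
    intro b
    have hp : ∀ i j, HasStrictFDerivAt (fun Y : Fin (n + 1) → Fin (n + 1) → ℝ => Y i j)
        ((ContinuousLinearMap.proj (R := ℝ) j).comp
          (ContinuousLinearMap.proj (R := ℝ) (φ := fun _ : Fin (n + 1) => Fin (n + 1) → ℝ) i))
        (minkM n) := fun i j =>
      ((ContinuousLinearMap.proj (R := ℝ) j).comp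
          (ContinuousLinearMap.proj (R := ℝ) (φ := fun _ : Fin (n + 1) => Fin (n + 1) → ℝ)
            i)).hasStrictFDerivAt
    have := HasStrictFDerivAt.fun_sum (u := Finset.univ) fun c _ =>
      ((hp a c).mul_const (eps n c)).mul (hp c b)
    refine this.congr_fderiv ?_
    ext H
    simp [minkM, he, Finset.sum_add_distrib, eps_mul_self, two_mul, ← mul_assoc]
  have hΦ0 : Φ (minkM n) = minkM n := by
    funext a b
    simp only [Φ, minkM]
    by_cases h : a = b
    · subst h; simp [eps_mul_self]
    · simp [h]
  have hT : ∀ Y : Fin (n + 1) → Fin (n + 1) → ℝ, Φ (fun a b => Y b a) = fun a b => Φ Y b a := by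
    intro Y; funext a b
    exact Finset.sum_congr rfl fun c _ => by ring
  have htr : Continuous (fun Y : Fin (n + 1) → Fin (n + 1) → ℝ => fun a b => Y b a) := by fun_prop
  have hηT : (fun a b => minkM n b a) = minkM n := by
    funext a b; exact (isLor_minkM n).1 b a
  set F := hΦ.toOpenPartialHomeomorph Φ with hF
  have hFc : ∀ Y, F Y = Φ Y := fun Y => rfl
  have hsrc : F.source ∈ nhds (minkM n) := F.open_source.mem_nhds hΦ.mem_toOpenPartialHomeomorph_source
  have hgood : ∀ᶠ Y in nhds (minkM n), Y ∈ F.source ∧ (fun a b => Y b a) ∈ F.source ∧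
      (Matrix.of Y : Matrix _ _ ℝ).det ≠ 0 := by
    refine (Filter.Eventually.and hsrc ?_)
    refine Filter.Eventually.and ?_ ?_
    · have := htr.tendsto (minkM n)
      rw [hηT] at this
      exact this hsrc
    · have hc : Continuous (fun Y : Fin (n + 1) → Fin (n + 1) → ℝ =>
          (Matrix.of Y : Matrix _ _ ℝ).det) := by
        apply Continuous.matrix_det
        exact continuous_id
      exact hc.continuousAt.eventually_ne (isLor_minkM n).isUnit_det.ne_zero
  have hmap := hΦ.map_nhds_eq_of_equiv
  rw [hΦ0] at hmap
  rw [← hmap, Filter.eventually_map]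
  filter_upwards [hgood] with Y hY hsym
  have hYs : (fun a b => Y b a) = Y := by
    refine F.injOn hY.2.1 hY.1 ?_
    rw [hFc, hFc, hT]
    funext a b; exact (hsym a b).symm
  have : Φ Y = pullB (Matrix.of Y) (minkM n) := by
    funext a b
    simp only [Φ, pullB, minkM, Matrix.of_apply, mul_ite, mul_zero, Finset.sum_ite_eq,
      Finset.mem_univ, if_true]
    refine Finset.sum_congr rfl fun c _ => ?_
    rw [show Y b c = Y c b from congrFun (congrFun hYs c) b]
    ring
  rw [this]
  exact (isLor_minkM n).pullB hY.2.2.isUnit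

lemma IsLor.eventually {n : ℕ} {G : Fin (n + 1) → Fin (n + 1) → ℝ} (hG : IsLor G) :
    ∀ᶠ H in nhds G, (∀ a b, H a b = H b a) → IsLor H := by
  obtain ⟨-, M, hM, h⟩ := (isLor_iff G).1 hG
  have hc : Continuous (Paper.pullB M) := by
    unfold Paper.pullB; fun_prop
  have h1 := hc.tendsto G
  rw [h] at h1
  filter_upwards [h1.eventually (eventually_isLor_minkM n)] with H hH hs
  have h2 := (hH (pullB_symm M hs)).pullB (Matrix.isUnit_nonsing_inv_det _ hM)
  rwa [pullB_pullB, Matrix.nonsing_inv_mul _ hM, pullB_one] at h2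

/-- The basis `1`-forms. -/
def basisCov {n : ℕ} (c : Fin (n + 1)) : Fin (n + 1) → ℝ := Pi.single c 1

/-- The wedge product `θ₁ ∧ … ∧ θ_k` of `1`-forms, in components. -/
def wedge (n k : ℕ) : (Fin (n + 1) → ℝ) [⋀^Fin k]→ₗ[ℝ] ((Fin k → Fin (n + 1)) → ℝ) :=
  AlternatingMap.pi fun w => Matrix.detRowAlternating.compLinearMap (LinearMap.funLeft ℝ ℝ w)

lemma wedge_apply {n k : ℕ} (θ : Fin k → Fin (n + 1) → ℝ) (w : Fin k → Fin (n + 1)) :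
    wedge n k θ w = (Matrix.of fun i j => θ i (w j)).det := rfl

/-- The form `e_{v₁} ∧ … ∧ e_{v_k}`. -/
def basisForm {n k : ℕ} (v : Fin k → Fin (n + 1)) : (Fin k → Fin (n + 1)) → ℝ :=
  wedge n k fun i => basisCov (v i)

lemma isAlt_wedge {n k : ℕ} (θ : Fin k → Fin (n + 1) → ℝ) : IsAlt (wedge n k θ) := fun v σ => by
  rw [wedge_apply, wedge_apply, ← Matrix.det_permute']
  rfl

lemma isAlt_basisForm {n k : ℕ} (v : Fin k → Fin (n + 1)) : IsAlt (basisForm v) := isAlt_wedge _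

lemma pullF_wedge {n k : ℕ} (M : Matrix (Fin (n + 1)) (Fin (n + 1)) ℝ)
    (θ : Fin k → Fin (n + 1) → ℝ) :
    pullF M (wedge n k θ) = wedge n k fun i => M.mulVec (θ i) := by
  funext v
  simp only [pullF, wedge_apply, Matrix.det_apply, Matrix.of_apply, Finset.mul_sum]
  rw [Finset.sum_comm]
  refine Finset.sum_congr rfl fun σ _ => ?_
  simp only [Matrix.mulVec, dotProduct]
  rw [Finset.prod_univ_sum, Fintype.piFinset_univ, Finset.smul_sum]
  refine Finset.sum_congr rfl fun u _ => ?_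
  rw [Finset.prod_mul_distrib, mul_smul_comm]

lemma sum_mul_basisForm {n k : ℕ} {w : (Fin k → Fin (n + 1)) → ℝ} (hw : IsAlt w)
    (u : Fin k → Fin (n + 1)) : ∑ v, w v * basisForm v u = (k.factorial : ℝ) * w u := by
  simp only [basisForm, wedge_apply, Matrix.det_apply, Matrix.of_apply, Finset.mul_sum]
  rw [Finset.sum_comm]
  have : ∀ σ : Equiv.Perm (Fin k), ∑ v : Fin k → Fin (n + 1),
      w v * (Equiv.Perm.sign σ • ∏ i, basisCov (v (σ i)) (u i)) = w u := fun σ => by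
    rw [Finset.sum_eq_single (u ∘ σ.symm)]
    · have h1 : ∏ i, basisCov ((u ∘ σ.symm) (σ i)) (u i) = (1 : ℝ) := by
        simp [basisCov]
      rw [h1, hw, Equiv.Perm.sign_symm]
      rcases Int.units_eq_one_or (Equiv.Perm.sign σ) with h | h <;> simp [h]
    · intro v _ hv
      have : ∃ i, v (σ i) ≠ u i := by
        by_contra! h
        apply hv
        funext i
        simp [← h]
      obtain ⟨i, hi⟩ := this
      rw [Finset.prod_eq_zero (Finset.mem_univ i)]
      · simp
      · simp [basisCov, Ne.symm hi]
    · simp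
  rw [Finset.sum_congr rfl fun σ _ => this σ]
  simp [Fintype.card_perm]

lemma IsAlt.eq_sum_basisForm {n k : ℕ} {w : (Fin k → Fin (n + 1)) → ℝ} (hw : IsAlt w) :
    w = ∑ v, ((k.factorial : ℝ)⁻¹ * w v) • basisForm v := by
  funext u
  have h := sum_mul_basisForm hw u
  have hk : (k.factorial : ℝ) ≠ 0 := by positivity
  simp only [Finset.sum_apply, Pi.smul_apply, smul_eq_mul, mul_assoc, ← Finset.mul_sum]
  rw [h]
  field_simp

lemma basisForm_of_not_injective {n k : ℕ} {v : Fin k → Fin (n + 1)}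
    (hv : ¬ Function.Injective v) : basisForm v = 0 := by
  refine AlternatingMap.map_eq_zero_of_not_injective _ _ fun h => hv fun i j hij => h ?_
  simp [hij]

lemma basisForm_eq_or_neg {n k : ℕ} {u v : Fin k → Fin (n + 1)} (hu : Function.Injective u)
    (hv : Function.Injective v) (h : Set.range u = Set.range v) :
    basisForm u = basisForm v ∨ basisForm u = -basisForm v := by
  let σ : Equiv.Perm (Fin k) := (Equiv.ofInjective u hu).trans
    ((Equiv.setCongr h).trans (Equiv.ofInjective v hv).symm)
  have hσ : ∀ i, u i = v (σ i) := fun i => by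
    simp [σ, Equiv.apply_ofInjective_symm]
  have : basisForm u = Equiv.Perm.sign σ • basisForm v := by
    rw [basisForm, basisForm, ← AlternatingMap.map_perm]
    congr 1
    funext i
    simp [hσ]
  rcases Int.units_eq_one_or (Equiv.Perm.sign σ) with h | h <;> simp [this, h]

/-- The rotation (or boost) in the coordinate plane `(c, d)`. -/
def planeRot {n : ℕ} (c d : Fin (n + 1)) (C S : ℝ) : Matrix (Fin (n + 1)) (Fin (n + 1)) ℝ :=
  Matrix.of fun a => if a = c then Pi.single c C + Pi.single d (-(eps n c * eps n d * S))
    else if a = d then Pi.single c S + Pi.single d C else Pi.single a 1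

lemma exists_planeRot_coeffs {n : ℕ} (c d : Fin (n + 1)) :
    ∃ C S : ℝ, C ≠ 0 ∧ S ≠ 0 ∧ C ^ 2 + eps n c * eps n d * S ^ 2 = 1 := by
  have : eps n c * eps n d = 1 ∨ eps n c * eps n d = -1 := by
    unfold eps; split_ifs <;> norm_num
  rcases this with h | h
  · exact ⟨3 / 5, 4 / 5, by norm_num, by norm_num, by rw [h]; norm_num⟩
  · exact ⟨5 / 4, 3 / 4, by norm_num, by norm_num, by rw [h]; norm_num⟩

lemma sum_single_add_mul {n : ℕ} (c d : Fin (n + 1)) (p q : ℝ) (f : Fin (n + 1) → ℝ) :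
    ∑ x, (Pi.single c p + Pi.single d q : Fin (n + 1) → ℝ) x * f x = p * f c + q * f d := by
  simp [add_mul, Finset.sum_add_distrib, Pi.single_apply]

lemma sum_single_mul {n : ℕ} (c : Fin (n + 1)) (f : Fin (n + 1) → ℝ) :
    ∑ x, (Pi.single c 1 : Fin (n + 1) → ℝ) x * f x = f c := by
  simp [Pi.single_apply]

lemma planeRot_row {n : ℕ} {c d : Fin (n + 1)} (hcd : c ≠ d) (C S : ℝ) (f : Fin (n + 1) → ℝ) :
    (∑ y, planeRot c d C S c y * f y = C * f c + -(eps n c * eps n d * S) * f d) ∧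
    (∑ y, planeRot c d C S d y * f y = S * f c + C * f d) ∧
    (∀ a, a ≠ c → a ≠ d → ∑ y, planeRot c d C S a y * f y = f a) := by
  refine ⟨?_, ?_, fun a hc hd => ?_⟩
  · rw [← sum_single_add_mul]; simp [planeRot]
  · rw [← sum_single_add_mul]; simp [planeRot, hcd.symm]
  · rw [← sum_single_mul a f]; simp [planeRot, hc, hd]

lemma pullB_planeRot_apply {n : ℕ} {c d : Fin (n + 1)} (hcd : c ≠ d) (C S : ℝ)
    (G : Fin (n + 1) → Fin (n + 1) → ℝ) :
    (∀ b, pullB (planeRot c d C S) G c b =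
      C * ∑ y, planeRot c d C S b y * G c y
        + -(eps n c * eps n d * S) * ∑ y, planeRot c d C S b y * G d y) ∧
    (∀ b, pullB (planeRot c d C S) G d b =
      S * ∑ y, planeRot c d C S b y * G c y + C * ∑ y, planeRot c d C S b y * G d y) ∧
    (∀ a b, a ≠ c → a ≠ d → pullB (planeRot c d C S) G a b =
      ∑ y, planeRot c d C S b y * G a y) := by
  have h : ∀ a b, pullB (planeRot c d C S) G a b =
      ∑ x, planeRot c d C S a x * ∑ y, planeRot c d C S b y * G x y := fun a b => by
    simp only [pullB, Finset.mul_sum, mul_assoc]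
  refine ⟨fun b => ?_, fun b => ?_, fun a b hc hd => ?_⟩
  · rw [h]
    exact (planeRot_row hcd C S fun x => ∑ y, planeRot c d C S b y * G x y).1
  · rw [h]
    exact (planeRot_row hcd C S fun x => ∑ y, planeRot c d C S b y * G x y).2.1
  · rw [h]
    exact (planeRot_row hcd C S fun x => ∑ y, planeRot c d C S b y * G x y).2.2 a hc hd

lemma pullB_planeRot_minkM {n : ℕ} {c d : Fin (n + 1)} (hcd : c ≠ d) {C S : ℝ}
    (h : C ^ 2 + eps n c * eps n d * S ^ 2 = 1) :
    pullB (planeRot c d C S) (minkM n) = minkM n := by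
  have hc := eps_mul_self n c
  have hd := eps_mul_self n d
  obtain ⟨p1, p2, p3⟩ := pullB_planeRot_apply hcd C S (minkM n)
  have row := fun f => planeRot_row (n := n) hcd C S f
  have m : ∀ x y, x ≠ y → minkM n x y = 0 := fun x y hxy => by simp [minkM, hxy]
  have m' : ∀ x, minkM n x x = eps n x := fun x => by simp [minkM]
  funext a b
  have hb : ∀ f : Fin (n + 1) → ℝ, b ≠ c → b ≠ d → ∑ y, planeRot c d C S b y * f y = f b :=
    fun f => (row f).2.2 b
  have r1 := fun f => (row f).1
  have r2 := fun f => (row f).2.1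
  by_cases hac : a = c
  · subst hac
    rw [p1]
    by_cases hbc : b = a
    · subst hbc
      rw [r1, r1, m _ _ hcd, m _ _ hcd.symm, m', m']
      linear_combination eps n b * h + eps n b ^ 2 * S ^ 2 * eps n d * hd
    · by_cases hbd : b = d
      · subst hbd
        rw [r2, r2, m _ _ hcd, m _ _ hcd.symm, m', m']
        linear_combination (-(S * C * eps n a)) * hd
      · rw [hb _ hbc hbd, hb _ hbc hbd, m _ _ (Ne.symm hbc), m _ _ (Ne.symm hbd)]
        ring
  · by_cases had : a = d
    · subst had
      rw [p2]
      by_cases hbc : b = c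
      · subst hbc
        rw [r1, r1, m _ _ hcd, m _ _ hcd.symm, m', m']
        linear_combination (-(S * C * eps n b)) * hd
      · by_cases hbd : b = a
        · subst hbd
          rw [r2, r2, m _ _ hcd, m _ _ hcd.symm, m', m']
          linear_combination eps n b * h - eps n c * S ^ 2 * hd
        · rw [hb _ hbc hbd, hb _ hbc hbd, m _ _ (Ne.symm hbc), m _ _ (Ne.symm hbd)]
          ring
    · rw [p3 _ _ hac had]
      by_cases hbc : b = c
      · subst hbc
        rw [r1, m _ _ hac, m _ _ had]
        ring
      · by_cases hbd : b = d
        · subst hbd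
          rw [r2, m _ _ hac, m _ _ had]
          ring
        · rw [hb _ hbc hbd]

lemma planeRot_mulVec {n : ℕ} {c d : Fin (n + 1)} (hcd : c ≠ d) (C S : ℝ) :
    (planeRot c d C S).mulVec (basisCov c) = C • basisCov c + S • basisCov d ∧
    (planeRot c d C S).mulVec (basisCov d) =
      (-(eps n c * eps n d * S)) • basisCov c + C • basisCov d ∧
    ∀ b, b ≠ c → b ≠ d → (planeRot c d C S).mulVec (basisCov b) = basisCov b := by
  refine ⟨?_, ?_, fun b hc hd => ?_⟩ <;> funext a <;>
    simp only [Matrix.mulVec, dotProduct, basisCov, planeRot, Matrix.of_apply] <;>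
    by_cases h1 : a = c <;> by_cases h2 : a = d <;>
    simp_all [Pi.single_apply, eq_comm]

/-- The reflection of the coordinate `c`. -/
def flip {n : ℕ} (c : Fin (n + 1)) : Matrix (Fin (n + 1)) (Fin (n + 1)) ℝ :=
  Matrix.diagonal fun x => if x = c then -1 else 1

lemma pullB_flip {n : ℕ} (c : Fin (n + 1)) (G : Fin (n + 1) → Fin (n + 1) → ℝ)
    (a b : Fin (n + 1)) :
    pullB (flip c) G a b = (if a = c then -1 else 1) * (if b = c then -1 else 1) * G a b := by
  simp [pullB, flip, Matrix.diagonal_apply]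

lemma pullB_flip_minkM {n : ℕ} (c : Fin (n + 1)) : pullB (flip c) (minkM n) = minkM n := by
  funext a b
  rw [pullB_flip]
  by_cases h : a = b
  · subst h; split_ifs <;> simp
  · simp [minkM, h]

lemma pullF_flip {n k : ℕ} (c : Fin (n + 1)) {v : Fin k → Fin (n + 1)}
    (hv : Function.Injective v) : (c ∈ Set.range v → pullF (flip c) (basisForm v) = -basisForm v) ∧
      (c ∉ Set.range v → pullF (flip c) (basisForm v) = basisForm v) := by
  have h1 : pullF (flip c) (basisForm v) = (∏ i, if v i = c then (-1 : ℝ) else 1) • basisForm v := by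
    have := (wedge n k).toMultilinearMap.map_smul_univ (fun i => if v i = c then (-1 : ℝ) else 1)
      (fun i => basisCov (v i))
    rw [basisForm, pullF_wedge]
    refine Eq.trans ?_ this
    change _ = wedge n k _
    congr 1
    funext i x
    simp only [flip, Matrix.mulVec_diagonal, basisCov, Pi.smul_apply, smul_eq_mul]
    by_cases h : x = v i
    · subst h; simp
    · simp [h]
  constructor
  · rintro ⟨i, rfl⟩
    rw [h1]
    simp [hv.eq_iff]
  · intro h
    rw [h1, Finset.prod_eq_one, one_smul]
    intro i _
    rw [if_neg fun hi => h ⟨i, hi⟩]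

lemma pullF_planeRot_update {n k : ℕ} {v : Fin k → Fin (n + 1)} (hv : Function.Injective v)
    (j : Fin k) {d : Fin (n + 1)} (hd : d ∉ Set.range v) (C S : ℝ) :
    pullF (planeRot (v j) d C S) (basisForm v) =
      C • basisForm v + S • basisForm (Function.update v j d) := by
  have hcd : v j ≠ d := fun h => hd ⟨j, h⟩
  obtain ⟨h1, -, h3⟩ := planeRot_mulVec hcd C S
  have e1 : (fun i => (planeRot (v j) d C S).mulVec (basisCov (v i))) =
      Function.update (fun i => basisCov (v i)) j (C • basisCov (v j) + S • basisCov d) := by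
    funext i
    by_cases hi : i = j
    · subst hi; rw [Function.update_self, h1]
    · rw [Function.update_of_ne hi, h3 _ (fun h => hi (hv h)) (fun h => hd ⟨i, h⟩)]
  have e2 : (fun i => basisCov (Function.update v j d i)) =
      Function.update (fun i => basisCov (v i)) j (basisCov d) := by
    funext i
    by_cases hi : i = j
    · subst hi; simp
    · simp [hi]
  rw [basisForm, basisForm, pullF_wedge, e1, e2, AlternatingMap.map_update_add,
    AlternatingMap.map_update_smul, AlternatingMap.map_update_smul]
  congr 3
  exact Function.update_eq_self j _

lemma pullF_planeRot_of_notMem {n k : ℕ} {v : Fin k → Fin (n + 1)} {c d : Fin (n + 1)}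
    (hcd : c ≠ d) (hc : c ∉ Set.range v) (hd : d ∉ Set.range v) (C S : ℝ) :
    pullF (planeRot c d C S) (basisForm v) = basisForm v := by
  rw [basisForm, pullF_wedge]
  congr 1
  funext i
  exact (planeRot_mulVec hcd C S).2.2 _ (fun h => hc ⟨i, h⟩) (fun h => hd ⟨i, h⟩)

lemma pullF_planeRot_of_mem {n k : ℕ} {v : Fin k → Fin (n + 1)} (hv : Function.Injective v)
    {i j : Fin k} (hij : i ≠ j) {C S : ℝ}
    (h : C ^ 2 + eps n (v i) * eps n (v j) * S ^ 2 = 1) :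
    pullF (planeRot (v i) (v j) C S) (basisForm v) = basisForm v := by
  obtain ⟨h1, h2, h3⟩ := planeRot_mulVec (hv.ne hij) C S
  set θ : Fin k → Fin (n + 1) → ℝ := fun l => basisCov (v l) with hθ
  have e1 : (fun l => (planeRot (v i) (v j) C S).mulVec (basisCov (v l))) =
      Function.update (Function.update θ i (C • θ i + S • θ j)) j
        ((-(eps n (v i) * eps n (v j) * S)) • θ i + C • θ j) := by
    funext l
    by_cases hl : l = j
    · subst hl; rw [Function.update_self, h2]
    · rw [Function.update_of_ne hl]
      by_cases hl' : l = i
      · subst hl'; rw [Function.update_self, h1]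
      · rw [Function.update_of_ne hl', h3 _ (hv.ne hl') (hv.ne hl)]
  have z1 : ∀ x, wedge n k (Function.update (Function.update θ i x) j x) = 0 := fun x =>
    (wedge n k).map_eq_zero_of_eq _ (by simp [hij]) hij
  have z2 : wedge n k (Function.update (Function.update θ i (θ i)) j (θ j)) = wedge n k θ := by
    simp
  have z3 : wedge n k (Function.update (Function.update θ i (θ j)) j (θ i)) = -wedge n k θ := by
    rw [← (wedge n k).map_swap θ hij]
    congr 1
    funext l
    by_cases hl : l = j
    · subst hl; simp
    · by_cases hl' : l = i
      · subst hl'; simp [hl]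
      · simp [hl, hl', Equiv.swap_apply_of_ne_of_ne hl' hl]
  have lin : ∀ y, wedge n k (Function.update (Function.update θ i (C • θ i + S • θ j)) j y) =
      C • wedge n k (Function.update (Function.update θ i (θ i)) j y) +
      S • wedge n k (Function.update (Function.update θ i (θ j)) j y) := fun y => by
    rw [Function.update_comm hij, AlternatingMap.map_update_add, AlternatingMap.map_update_smul,
      AlternatingMap.map_update_smul, Function.update_comm hij, Function.update_comm hij]
  rw [basisForm, pullF_wedge, e1, AlternatingMap.map_update_add, AlternatingMap.map_update_smul,
    AlternatingMap.map_update_smul, lin, lin, z1, z1, z2, z3]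
  change _ = wedge n k θ
  funext w
  simp only [Pi.add_apply, Pi.smul_apply, Pi.neg_apply, Pi.zero_apply, smul_eq_mul]
  linear_combination wedge n k θ w * h

lemma pullF_add {n k : ℕ} (M : Matrix (Fin (n + 1)) (Fin (n + 1)) ℝ)
    (w u : (Fin k → Fin (n + 1)) → ℝ) : pullF M (w + u) = pullF M w + pullF M u := by
  funext v
  simp [pullF, mul_add, Finset.sum_add_distrib]

section Equivariant

variable {n k : ℕ}
  {B : Fin (n + 1) → Fin (n + 1) →
    ((Fin k → Fin (n + 1)) → ℝ) →ₗ[ℝ] ((Fin k → Fin (n + 1)) → ℝ) →ₗ[ℝ] ℝ}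

/-- Lorentz equivariance of the quadratic map `w ↦ B(w, w)` on alternating forms. -/
def IsEquivariant (B : Fin (n + 1) → Fin (n + 1) →
    ((Fin k → Fin (n + 1)) → ℝ) →ₗ[ℝ] ((Fin k → Fin (n + 1)) → ℝ) →ₗ[ℝ] ℝ) : Prop :=
  ∀ M : Matrix (Fin (n + 1)) (Fin (n + 1)) ℝ, pullB M (minkM n) = minkM n → ∀ w, IsAlt w →
    ∀ a b, B a b (pullF M w) (pullF M w) = pullB M (fun a b => B a b w w) a b

lemma IsEquivariant.polar (hB : IsEquivariant B) {M : Matrix (Fin (n + 1)) (Fin (n + 1)) ℝ}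
    (hM : pullB M (minkM n) = minkM n) {w u : (Fin k → Fin (n + 1)) → ℝ} (hw : IsAlt w)
    (hu : IsAlt u) (a b : Fin (n + 1)) :
    B a b (pullF M w) (pullF M u) + B a b (pullF M u) (pullF M w) =
      pullB M (fun a b => B a b w u + B a b u w) a b := by
  have h1 := hB M hM w hw a b
  have h2 := hB M hM u hu a b
  have h3 := hB M hM (w + u) (hw.add hu) a b
  simp only [pullF_add, map_add, LinearMap.add_apply] at h3
  simp only [pullB] at h1 h2 h3 ⊢
  simp only [mul_add, Finset.sum_add_distrib] at h3 ⊢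
  linarith

/-- The sign by which the reflection of `p` acts. -/
lemma exists_flip_sign {v : Fin k → Fin (n + 1)} (hv : Function.Injective v)
    (p : Fin (n + 1)) :
    pullF (flip p) (basisForm v) = (if p ∈ Set.range v then -1 else 1 : ℝ) • basisForm v := by
  split_ifs with h
  · rw [(pullF_flip p hv).1 h, neg_one_smul]
  · rw [(pullF_flip p hv).2 h, one_smul]

lemma IsEquivariant.polar_flip (hB : IsEquivariant B) {v u : Fin k → Fin (n + 1)}
    (hv : Function.Injective v) (hu : Function.Injective u) (p a b : Fin (n + 1)) :
    (if p ∈ Set.range v then -1 else 1 : ℝ) * (if p ∈ Set.range u then -1 else 1) *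
        (B a b (basisForm v) (basisForm u) + B a b (basisForm u) (basisForm v)) =
      (if a = p then -1 else 1) * (if b = p then -1 else 1) *
        (B a b (basisForm v) (basisForm u) + B a b (basisForm u) (basisForm v)) := by
  have h := hB.polar (pullB_flip_minkM p) (isAlt_basisForm v) (isAlt_basisForm u) a b
  rw [pullB_flip, exists_flip_sign hv, exists_flip_sign hu] at h
  simp only [map_smul, LinearMap.smul_apply, smul_eq_mul] at h
  rw [← h]
  ring

lemma IsEquivariant.offDiag (hB : IsEquivariant B) {v : Fin k → Fin (n + 1)}
    (hv : Function.Injective v) {a b : Fin (n + 1)} (hab : a ≠ b) :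
    B a b (basisForm v) (basisForm v) = 0 := by
  have h := hB.polar_flip hv hv a a b
  rw [if_pos rfl, if_neg hab.symm] at h
  split_ifs at h <;> linarith

lemma IsEquivariant.diag_eq_zero (hB : IsEquivariant B) {v : Fin k → Fin (n + 1)}
    (hv : Function.Injective v) {c d : Fin (n + 1)}
    (hcd : c ∈ Set.range v ↔ d ∈ Set.range v)
    (hc : B c c (basisForm v) (basisForm v) = 0) : B d d (basisForm v) (basisForm v) = 0 := by
  by_cases hne : c = d
  · rwa [← hne]
  obtain ⟨C, S, hC, hS, h⟩ := exists_planeRot_coeffs c d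
  have hfix : pullF (planeRot c d C S) (basisForm v) = basisForm v := by
    by_cases hcv : c ∈ Set.range v
    · obtain ⟨j, hj⟩ := hcd.1 hcv
      obtain ⟨i, hi⟩ := hcv
      subst hi hj
      exact pullF_planeRot_of_mem hv (fun hij => hne (by rw [hij])) h
    · exact pullF_planeRot_of_notMem hne hcv (fun hd => hcv (hcd.2 hd)) C S
  have key := hB _ (pullB_planeRot_minkM hne h) _ (isAlt_basisForm v) c c
  rw [hfix, (pullB_planeRot_apply hne C S _).1, (planeRot_row hne C S _).1,
    (planeRot_row hne C S _).1, hB.offDiag hv hne, hB.offDiag hv (Ne.symm hne), hc] at key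
  have h1 := eps_mul_self n c
  have h2 := eps_mul_self n d
  have : S ^ 2 * B d d (basisForm v) (basisForm v) = 0 := by
    linear_combination (-1 : ℝ) * key - S ^ 2 * B d d (basisForm v) (basisForm v) * h1 -
      S ^ 2 * B d d (basisForm v) (basisForm v) * eps n c ^ 2 * h2
  simpa [hS] using this

lemma update_injective {v : Fin k → Fin (n + 1)} (hv : Function.Injective v) (j : Fin k)
    {d : Fin (n + 1)} (hd : d ∉ Set.range v) : Function.Injective (Function.update v j d) := by
  intro x y hxy
  by_cases hx : x = j <;> by_cases hy : y = j
  · rw [hx, hy]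
  · subst hx
    rw [Function.update_self, Function.update_of_ne hy] at hxy
    exact absurd ⟨y, hxy.symm⟩ hd
  · subst hy
    rw [Function.update_self, Function.update_of_ne hx] at hxy
    exact absurd ⟨x, hxy⟩ hd
  · rw [Function.update_of_ne hx, Function.update_of_ne hy] at hxy
    exact hv hxy

lemma notMem_range_update {v : Fin k → Fin (n + 1)} (hv : Function.Injective v) (j : Fin k)
    {d : Fin (n + 1)} (hd : d ∉ Set.range v) : v j ∉ Set.range (Function.update v j d) := by
  rintro ⟨x, hx⟩
  by_cases hxj : x = j
  · subst hxj
    rw [Function.update_self] at hx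
    exact hd ⟨x, hx.symm⟩
  · rw [Function.update_of_ne hxj] at hx
    exact hxj (hv hx)

lemma IsEquivariant.exchange (hB : IsEquivariant B) {v : Fin k → Fin (n + 1)}
    (hv : Function.Injective v) (hZ : ∀ a b, B a b (basisForm v) (basisForm v) = 0) (j : Fin k)
    {d : Fin (n + 1)} (hd : d ∉ Set.range v) :
    (∀ a b, B a b (basisForm (Function.update v j d)) (basisForm (Function.update v j d)) = 0) ∧
    ∀ a b, B a b (basisForm v) (basisForm (Function.update v j d)) +
      B a b (basisForm (Function.update v j d)) (basisForm v) = 0 := by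
  have hv' := update_injective hv j hd
  have hne : v j ≠ d := fun h => hd ⟨j, h⟩
  obtain ⟨C, S, hC, hS, h⟩ := exists_planeRot_coeffs (v j) d
  have key : ∀ a b, C * (B a b (basisForm v) (basisForm (Function.update v j d)) +
      B a b (basisForm (Function.update v j d)) (basisForm v)) + S *
      B a b (basisForm (Function.update v j d)) (basisForm (Function.update v j d)) = 0 := by
    intro a b
    have h1 := hB _ (pullB_planeRot_minkM hne h) _ (isAlt_basisForm v) a b
    rw [pullF_planeRot_update hv j hd] at h1
    simp only [hZ, map_add, map_smul, LinearMap.add_apply, LinearMap.smul_apply, smul_eq_mul,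
      pullB, mul_zero, Finset.sum_const_zero] at h1
    have : S * (C * (B a b (basisForm v) (basisForm (Function.update v j d)) +
      B a b (basisForm (Function.update v j d)) (basisForm v)) + S *
      B a b (basisForm (Function.update v j d)) (basisForm (Function.update v j d))) = 0 := by
      linarith
    simpa [hS] using this
  have hZ' : ∀ a b,
      B a b (basisForm (Function.update v j d)) (basisForm (Function.update v j d)) = 0 := by
    intro a b
    by_cases hab : a = b
    · subst hab
      have h1 := hB.polar_flip hv hv' (v j) a a
      rw [if_pos ⟨j, rfl⟩, if_neg (notMem_range_update hv j hd)] at h1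
      have h2 : B a a (basisForm v) (basisForm (Function.update v j d)) +
          B a a (basisForm (Function.update v j d)) (basisForm v) = 0 := by
        split_ifs at h1 <;> linarith
      have h3 := key a a
      rw [h2] at h3
      simpa [hS] using h3
    · exact hB.offDiag hv' hab
  refine ⟨hZ', fun a b => ?_⟩
  have h3 := key a b
  rw [hZ'] at h3
  simpa [hC] using h3

lemma exists_mem_range_notMem {v u : Fin k → Fin (n + 1)} (hv : Function.Injective v)
    (hu : Function.Injective u) (h : Set.range v ≠ Set.range u) :
    ∃ i, v i ∉ Set.range u := by
  by_contra! hcon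
  refine h (Set.eq_of_subset_of_ncard_le ?_ ?_ (Set.finite_range u))
  · rintro _ ⟨i, rfl⟩; exact hcon i
  · rw [← Set.image_univ, ← Set.image_univ, Set.ncard_image_of_injective _ hu,
      Set.ncard_image_of_injective _ hv]

lemma IsEquivariant.diag_basisForm (hB : IsEquivariant B) {v₀ : Fin k → Fin (n + 1)}
    (hv₀ : Function.Injective v₀) (hZ : ∀ a b, B a b (basisForm v₀) (basisForm v₀) = 0) :
    ∀ v : Fin k → Fin (n + 1), Function.Injective v →
      ∀ a b, B a b (basisForm v) (basisForm v) = 0 := by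
  suffices H : ∀ N, ∀ v : Fin k → Fin (n + 1), Function.Injective v →
      (Set.range v \ Set.range v₀).ncard = N → ∀ a b, B a b (basisForm v) (basisForm v) = 0 from
    fun v hv => H _ v hv rfl
  intro N
  induction N using Nat.strong_induction_on with
  | _ N ih =>
    intro v hv hN
    by_cases hr : Set.range v = Set.range v₀
    · intro a b
      rcases basisForm_eq_or_neg hv hv₀ hr with h | h <;> simp [h, hZ]
    · obtain ⟨j, hj⟩ := exists_mem_range_notMem hv hv₀ hr
      obtain ⟨i, hi⟩ := exists_mem_range_notMem hv₀ hv (Ne.symm hr)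
      have hv' := update_injective hv j hi
      have hlt : (Set.range (Function.update v j (v₀ i)) \ Set.range v₀).ncard < N := by
        rw [← hN]
        refine Set.ncard_lt_ncard ⟨?_, ?_⟩ (Set.toFinite _)
        · rintro _ ⟨⟨x, rfl⟩, hx⟩
          by_cases hxj : x = j
          · subst hxj
            rw [Function.update_self] at hx
            exact absurd ⟨i, rfl⟩ hx
          · rw [Function.update_of_ne hxj] at hx ⊢
            exact ⟨⟨x, rfl⟩, hx⟩
        · intro hsub
          exact notMem_range_update hv j hi (hsub ⟨⟨j, rfl⟩, hj⟩).1
      have hZ' := ih _ hlt _ hv' rfl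
      have := (hB.exchange hv' hZ' j (notMem_range_update hv j hi)).1
      simpa using this

lemma IsEquivariant.polar_basisForm (hB : IsEquivariant B)
    (hZ : ∀ v : Fin k → Fin (n + 1), Function.Injective v →
      ∀ a b, B a b (basisForm v) (basisForm v) = 0) (v u : Fin k → Fin (n + 1))
    (a b : Fin (n + 1)) :
    B a b (basisForm v) (basisForm u) + B a b (basisForm u) (basisForm v) = 0 := by
  by_cases hv : Function.Injective v
  swap
  · simp [basisForm_of_not_injective hv]
  by_cases hu : Function.Injective u
  swap
  · simp [basisForm_of_not_injective hu]
  by_cases hr : Set.range v = Set.range u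
  · rcases basisForm_eq_or_neg hv hu hr with h | h <;> simp [h, hZ u hu]
  obtain ⟨j, hj⟩ := exists_mem_range_notMem hv hu hr
  obtain ⟨i, hi⟩ := exists_mem_range_notMem hu hv (Ne.symm hr)
  have hflip := fun p => hB.polar_flip hv hu p a b
  by_contra hne
  have hsign := fun p => mul_right_cancel₀ hne (hflip p)
  have hc := hsign (v j)
  have hd := hsign (u i)
  rw [if_pos ⟨j, rfl⟩, if_neg hj] at hc
  rw [if_neg hi, if_pos ⟨i, rfl⟩] at hd
  have hcd : v j ≠ u i := fun h => hj ⟨i, h.symm⟩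
  have hother : ∀ p, p ≠ v j → p ≠ u i → (p ∈ Set.range v ↔ p ∈ Set.range u) := by
    intro p hp1 hp2
    have hap : a ≠ p ∧ b ≠ p := by
      split_ifs at hc hd <;> first | (norm_num at hc; done) | (norm_num at hd; done) | grind
    have hp := hsign p
    rw [if_neg hap.1, if_neg hap.2] at hp
    by_cases h1 : p ∈ Set.range v <;> by_cases h2 : p ∈ Set.range u <;>
      simp only [h1, h2, if_true, if_false] at hp ⊢ <;> norm_num at hp
  have hrange : Set.range (Function.update v j (u i)) = Set.range u := by
    refine Set.eq_of_subset_of_ncard_le ?_ ?_ (Set.finite_range u)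
    · rintro _ ⟨x, rfl⟩
      by_cases hx : x = j
      · subst hx; rw [Function.update_self]; exact ⟨i, rfl⟩
      · rw [Function.update_of_ne hx]
        exact (hother _ (hv.ne hx) fun h => hi ⟨x, h⟩).1 ⟨x, rfl⟩
    · rw [← Set.image_univ, ← Set.image_univ, Set.ncard_image_of_injective _ hu,
        Set.ncard_image_of_injective _ (update_injective hv j hi)]
  have hex := (hB.exchange hv (hZ v hv) j hi).2 a b
  apply hne
  rcases basisForm_eq_or_neg hu (update_injective hv j hi) hrange.symm with h | h
  · rw [h]; exact hex
  · rw [h]; simp only [map_neg, LinearMap.neg_apply]; linarith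

/-- A Lorentz-equivariant quadratic map from `k`-forms to bilinear forms vanishes as soon as its
diagonal entries on one basis form vanish, at one index inside and one index outside of it. -/
theorem IsEquivariant.eq_zero (hB : IsEquivariant B) {v₀ : Fin k → Fin (n + 1)}
    (hv₀ : Function.Injective v₀)
    (hin : ∀ c, c ∈ Set.range v₀ → ∃ d ∈ Set.range v₀, B d d (basisForm v₀) (basisForm v₀) = 0)
    (hout : ∀ c, c ∉ Set.range v₀ → ∃ d ∉ Set.range v₀, B d d (basisForm v₀) (basisForm v₀) = 0)
    {w : (Fin k → Fin (n + 1)) → ℝ} (hw : IsAlt w) (a b : Fin (n + 1)) : B a b w w = 0 := by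
  have hZ₀ : ∀ a b, B a b (basisForm v₀) (basisForm v₀) = 0 := by
    intro a b
    by_cases hab : a = b
    · subst hab
      by_cases ha : a ∈ Set.range v₀
      · obtain ⟨d, hd, h⟩ := hin a ha
        exact hB.diag_eq_zero hv₀ (by simp [ha, hd]) h
      · obtain ⟨d, hd, h⟩ := hout a ha
        exact hB.diag_eq_zero hv₀ (by simp [ha, hd]) h
    · exact hB.offDiag hv₀ hab
  have hβ := hB.polar_basisForm (hB.diag_basisForm hv₀ hZ₀)
  have key : ∀ x : (Fin k → Fin (n + 1)) → ℝ,
      B a b (∑ v, x v • basisForm v) (∑ v, x v • basisForm v) = 0 := by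
    intro x
    have h1 : B a b (∑ v, x v • basisForm v) (∑ v, x v • basisForm v) =
        ∑ v, ∑ u, x v * x u * B a b (basisForm v) (basisForm u) := by
      simp only [map_sum, map_smul, LinearMap.sum_apply, LinearMap.smul_apply, smul_eq_mul,
        Finset.mul_sum]
      rw [Finset.sum_comm]
      exact Finset.sum_congr rfl fun _ _ => Finset.sum_congr rfl fun _ _ => by ring
    have h2 : ∑ v, ∑ u, x v * x u * B a b (basisForm v) (basisForm u) =
        -∑ v, ∑ u, x v * x u * B a b (basisForm v) (basisForm u) := by
      conv_rhs => rw [Finset.sum_comm]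
      rw [← Finset.sum_neg_distrib]
      refine Finset.sum_congr rfl fun v _ => ?_
      rw [← Finset.sum_neg_distrib]
      refine Finset.sum_congr rfl fun u _ => ?_
      linear_combination x v * x u * hβ v u a b
    rw [h1]
    linarith
  rw [hw.eq_sum_basisForm]
  exact key _

end Equivariant

/-- The full contraction of two covariant tensors with the contravariant form `K`. -/
def contr {n m : ℕ} (K : Matrix (Fin (n + 1)) (Fin (n + 1)) ℝ)
    (w u : (Fin m → Fin (n + 1)) → ℝ) : ℝ :=
  ∑ v : Fin m → Fin (n + 1), ∑ v' : Fin m → Fin (n + 1), (∏ j, K (v j) (v' j)) * w v * u v'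

lemma contr_eq_sum_mul {n m : ℕ} (K : Matrix (Fin (n + 1)) (Fin (n + 1)) ℝ)
    (w u : (Fin m → Fin (n + 1)) → ℝ) : contr K w u = ∑ v, w v * pullF K u v := by
  simp only [contr, pullF, Finset.mul_sum]
  exact Finset.sum_congr rfl fun _ _ => Finset.sum_congr rfl fun _ _ => by ring

lemma sum_pullF_mul {n m : ℕ} (M : Matrix (Fin (n + 1)) (Fin (n + 1)) ℝ)
    (w u : (Fin m → Fin (n + 1)) → ℝ) :
    ∑ v, pullF M w v * u v = ∑ v, w v * pullF M.transpose u v := by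
  simp only [pullF, Finset.mul_sum, Finset.sum_mul]
  rw [Finset.sum_comm]
  refine Finset.sum_congr rfl fun _ _ => Finset.sum_congr rfl fun _ _ => ?_
  simp only [Matrix.transpose_apply]
  ring

lemma contr_pullF {n m : ℕ} (K M : Matrix (Fin (n + 1)) (Fin (n + 1)) ℝ)
    (w u : (Fin m → Fin (n + 1)) → ℝ) :
    contr K (pullF M w) (pullF M u) = contr (M.transpose * K * M) w u := by
  rw [contr_eq_sum_mul, contr_eq_sum_mul, sum_pullF_mul, pullF_pullF, pullF_pullF,
    Matrix.mul_assoc]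

/-- `contr` as a bilinear map. -/
def contrL {n m : ℕ} (K : Matrix (Fin (n + 1)) (Fin (n + 1)) ℝ) :
    ((Fin m → Fin (n + 1)) → ℝ) →ₗ[ℝ] ((Fin m → Fin (n + 1)) → ℝ) →ₗ[ℝ] ℝ :=
  LinearMap.mk₂ ℝ (contr K)
    (fun w w' u => by simp [contr, mul_add, add_mul, Finset.sum_add_distrib])
    (fun c w u => by
      simp only [contr, Pi.smul_apply, smul_eq_mul, Finset.mul_sum]
      exact Finset.sum_congr rfl fun _ _ => Finset.sum_congr rfl fun _ _ => by ring)
    (fun w u u' => by simp [contr, mul_add, Finset.sum_add_distrib])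
    (fun c w u => by
      simp only [contr, Pi.smul_apply, smul_eq_mul, Finset.mul_sum]
      exact Finset.sum_congr rfl fun _ _ => Finset.sum_congr rfl fun _ _ => by ring)

@[simp] lemma contrL_apply {n m : ℕ} (K : Matrix (Fin (n + 1)) (Fin (n + 1)) ℝ)
    (w u : (Fin m → Fin (n + 1)) → ℝ) : contrL K w u = contr K w u := rfl

/-- The scalar product of forms, as a function of the inverse metric and the components. -/
noncomputable def scalarAt {n : ℕ} (k : ℕ) (K : Matrix (Fin (n + 1)) (Fin (n + 1)) ℝ)
    (w : (Fin k → Fin (n + 1)) → ℝ) : ℝ :=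
  (1 / (k.factorial : ℝ)) * contr K w w

/-- The tensor `⟨i_−ω, i_−ω⟩`, as a function of the inverse metric and the components. -/
noncomputable def innerAt {n : ℕ} (k : ℕ) (K : Matrix (Fin (n + 1)) (Fin (n + 1)) ℝ)
    (w : (Fin k → Fin (n + 1)) → ℝ) (a b : Fin (n + 1)) : ℝ :=
  (1 / ((k - 1).factorial : ℝ)) *
    contr K (fun v => w (dcons k a v)) (fun v => w (dcons k b v))

lemma scalarSq_eq {n k : ℕ} (g : Pt n → Fin (n + 1) → Fin (n + 1) → ℝ)
    (ω : Pt n → (Fin k → Fin (n + 1)) → ℝ) (x : Pt n) :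
    scalarSq n k g ω x = scalarAt k (Matrix.of (g x))⁻¹ (ω x) := rfl

lemma iiInner_eq {n k : ℕ} (g : Pt n → Fin (n + 1) → Fin (n + 1) → ℝ)
    (ω : Pt n → (Fin k → Fin (n + 1)) → ℝ) (x : Pt n) (a b : Fin (n + 1)) :
    iiInner n k g ω x a b = innerAt k (Matrix.of (g x))⁻¹ (ω x) a b := rfl

lemma dcons_succ {α : Type*} (m : ℕ) (a : α) (v : Fin m → α) :
    dcons (m + 1) a v = (Fin.cons a v : Fin (m + 1) → α) := by
  funext j
  refine Fin.cases ?_ (fun i => ?_) j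
  · simp [dcons]
  · simp [dcons]

lemma pullF_cons {n m : ℕ} (M : Matrix (Fin (n + 1)) (Fin (n + 1)) ℝ)
    (w : (Fin (m + 1) → Fin (n + 1)) → ℝ) (a : Fin (n + 1)) (v : Fin m → Fin (n + 1)) :
    pullF M w (Fin.cons a v : Fin (m + 1) → Fin (n + 1)) =
      ∑ c, M a c * pullF M (fun v => w (Fin.cons c v : Fin (m + 1) → Fin (n + 1))) v := by
  simp only [pullF, Finset.mul_sum]
  rw [← Fintype.sum_prod_type']
  refine (Fintype.sum_equiv (Fin.consEquiv fun _ => Fin (n + 1)) _ _ fun p => ?_).symm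
  simp [Fin.prod_univ_succ, Fin.consEquiv, mul_assoc]

lemma innerAt_pullF {n k : ℕ} (hk : 1 ≤ k) (K M : Matrix (Fin (n + 1)) (Fin (n + 1)) ℝ)
    (w : (Fin k → Fin (n + 1)) → ℝ) (a b : Fin (n + 1)) :
    innerAt k K (pullF M w) a b = pullB M (innerAt k (M.transpose * K * M) w) a b := by
  obtain ⟨m, rfl⟩ := Nat.exists_eq_add_of_le' hk
  have hrow : ∀ a, (fun v : Fin m → Fin (n + 1) => pullF M w (dcons (m + 1) a v)) =
      ∑ c, M a c • pullF M (fun v => w (dcons (m + 1) c v)) := fun a => by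
    funext v
    simp only [dcons_succ, pullF_cons, Finset.sum_apply, Pi.smul_apply, smul_eq_mul]
    rfl
  change (1 / (m.factorial : ℝ)) * contrL K (fun v : Fin m → Fin (n + 1) => _) (fun v => _) = _
  rw [hrow, hrow]
  simp only [map_sum, map_smul, LinearMap.sum_apply, LinearMap.smul_apply, contrL_apply,
    contr_pullF, smul_eq_mul, pullB, innerAt, Finset.mul_sum]
  rw [Finset.sum_comm]
  exact Finset.sum_congr rfl fun _ _ => Finset.sum_congr rfl fun _ _ => by
    simp only [Nat.add_sub_cancel]; ring

lemma scalarAt_pullF {n k : ℕ} (K M : Matrix (Fin (n + 1)) (Fin (n + 1)) ℝ)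
    (w : (Fin k → Fin (n + 1)) → ℝ) :
    scalarAt k K (pullF M w) = scalarAt k (M.transpose * K * M) w := by
  simp only [scalarAt, contr_pullF]

lemma transpose_mul_inv_mul {n : ℕ} {M : Matrix (Fin (n + 1)) (Fin (n + 1)) ℝ}
    (hM : IsUnit M.det) (G : Fin (n + 1) → Fin (n + 1) → ℝ) :
    M.transpose * (Matrix.of (pullB M G))⁻¹ * M = (Matrix.of G)⁻¹ := by
  have hM' : IsUnit M.transpose.det := by rwa [Matrix.det_transpose]
  rw [pullB_eq_mul, Matrix.mul_inv_rev, Matrix.mul_inv_rev, ← Matrix.mul_assoc,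
    Matrix.mul_nonsing_inv _ hM', Matrix.one_mul, Matrix.mul_assoc,
    Matrix.nonsing_inv_mul _ hM, Matrix.mul_one]

lemma isUnit_det_of_pullB_minkM {n : ℕ} {M : Matrix (Fin (n + 1)) (Fin (n + 1)) ℝ}
    (hM : pullB M (minkM n) = minkM n) : IsUnit M.det := by
  have h := (isLor_minkM n).isUnit_det
  rw [← hM, pullB_eq_mul, Matrix.det_mul, Matrix.det_mul] at h
  exact isUnit_of_mul_isUnit_left (isUnit_of_mul_isUnit_left h)

lemma contr_minkM {n m : ℕ} (w : (Fin m → Fin (n + 1)) → ℝ) :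
    contr (Matrix.of (minkM n))⁻¹ w w = ∑ v, (∏ j, eps n (v j)) * w v ^ 2 := by
  rw [Matrix.inv_eq_left_inv (minkM_mul_self n), contr]
  refine Finset.sum_congr rfl fun v _ => ?_
  rw [Finset.sum_eq_single v]
  · simp [minkM]; ring
  · intro u _ hu
    obtain ⟨j, hj⟩ := Function.ne_iff.1 hu
    rw [Finset.prod_eq_zero (Finset.mem_univ j), zero_mul, zero_mul]
    simp [minkM, hj.symm]
  · simp

lemma exists_perm_of_basisForm_ne_zero {n k : ℕ} {v u : Fin k → Fin (n + 1)}
    (h : basisForm v u ≠ 0) : ∃ σ : Equiv.Perm (Fin k), u = v ∘ σ := by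
  rw [basisForm, wedge_apply, Matrix.det_apply] at h
  obtain ⟨σ, -, hσ⟩ := Finset.exists_ne_zero_of_sum_ne_zero h
  refine ⟨σ, funext fun i => ?_⟩
  have : ∏ i, (Matrix.of fun i j => basisCov (v i) (u j) : Matrix _ _ ℝ) (σ i) i ≠ 0 :=
    fun h => hσ (by rw [h, smul_zero])
  have := Finset.prod_ne_zero_iff.1 this i (Finset.mem_univ i)
  simp only [basisCov, Matrix.of_apply, Pi.single_apply] at this
  by_contra hne
  exact this (if_neg hne)

lemma basisForm_self {n k : ℕ} {v : Fin k → Fin (n + 1)} (hv : Function.Injective v) :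
    basisForm v v = 1 := by
  rw [basisForm, wedge_apply]
  convert Matrix.det_one (n := Fin k) (R := ℝ)
  ext i j
  simp [basisCov, Pi.single_apply, Matrix.one_apply, hv.eq_iff, eq_comm]

lemma prod_eps_of_basisForm_ne_zero {n k : ℕ} {v u : Fin k → Fin (n + 1)}
    (h : basisForm v u ≠ 0) : ∏ j, eps n (u j) = ∏ j, eps n (v j) := by
  obtain ⟨σ, rfl⟩ := exists_perm_of_basisForm_ne_zero h
  exact Equiv.prod_comp σ fun j => eps n (v j)

lemma scalarAt_basisForm_ne_zero {n k : ℕ} {v : Fin k → Fin (n + 1)}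
    (hv : Function.Injective v) : scalarAt k (Matrix.of (minkM n))⁻¹ (basisForm v) ≠ 0 := by
  have h1 : contr (Matrix.of (minkM n))⁻¹ (basisForm v) (basisForm v) =
      (∏ j, eps n (v j)) * ∑ u, basisForm v u ^ 2 := by
    rw [contr_minkM, Finset.mul_sum]
    refine Finset.sum_congr rfl fun u _ => ?_
    by_cases h : basisForm v u = 0
    · simp [h]
    · rw [prod_eps_of_basisForm_ne_zero h]
  have h2 : 0 < ∑ u, basisForm v u ^ 2 :=
    Finset.sum_pos' (fun _ _ => sq_nonneg _) ⟨v, Finset.mem_univ v, by simp [basisForm_self hv]⟩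
  rw [scalarAt, h1]
  have h3 : ∏ j, eps n (v j) ≠ 0 := Finset.prod_ne_zero_iff.2 fun j _ => eps_ne_zero n _
  positivity

lemma innerAt_basisForm_of_notMem {n k : ℕ} (hk : 1 ≤ k) {v : Fin k → Fin (n + 1)}
    {a : Fin (n + 1)} (ha : a ∉ Set.range v) (K : Matrix (Fin (n + 1)) (Fin (n + 1)) ℝ)
    (b : Fin (n + 1)) : innerAt k K (basisForm v) a b = 0 := by
  obtain ⟨m, rfl⟩ := Nat.exists_eq_add_of_le' hk
  have : (fun u : Fin m → Fin (n + 1) => basisForm v (dcons (m + 1) a u)) = 0 := by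
    funext u
    by_contra h
    obtain ⟨σ, hσ⟩ := exists_perm_of_basisForm_ne_zero h
    have := congrFun hσ 0
    rw [dcons_succ, Fin.cons_zero] at this
    exact ha ⟨σ 0, this.symm⟩
  change _ * contrL K (fun u : Fin m → Fin (n + 1) => basisForm v (dcons (m + 1) a u)) _ = 0
  rw [this]
  simp

lemma innerAt_basisForm_ne_zero {n k : ℕ} (hk : 1 ≤ k) {v : Fin k → Fin (n + 1)}
    (hv : Function.Injective v) :
    innerAt k (Matrix.of (minkM n))⁻¹ (basisForm v) (v ⟨0, hk⟩) (v ⟨0, hk⟩) ≠ 0 := by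
  obtain ⟨m, rfl⟩ := Nat.exists_eq_add_of_le' hk
  change innerAt (m + 1) (Matrix.of (minkM n))⁻¹ (basisForm v) (v 0) (v 0) ≠ 0
  set f : (Fin m → Fin (n + 1)) → ℝ := fun u => basisForm v (dcons (m + 1) (v 0) u) with hf
  have h1 : contr (Matrix.of (minkM n))⁻¹ f f =
      (eps n (v 0) * ∏ j, eps n (v j)) * ∑ u, f u ^ 2 := by
    rw [contr_minkM, Finset.mul_sum]
    refine Finset.sum_congr rfl fun u _ => ?_
    by_cases h : f u = 0
    · simp [h]
    · rw [← prod_eps_of_basisForm_ne_zero h, dcons_succ, Fin.prod_univ_succ, Fin.cons_zero]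
      simp only [Fin.cons_succ]
      rw [← mul_assoc, eps_mul_self, one_mul]
  have h2 : 0 < ∑ u, f u ^ 2 := by
    refine Finset.sum_pos' (fun _ _ => sq_nonneg _) ⟨Fin.tail v, Finset.mem_univ _, ?_⟩
    have : f (Fin.tail v) = 1 := by
      rw [hf]
      simp only [dcons_succ, Fin.cons_self_tail]
      exact basisForm_self hv
    simp [this]
  have h3 : ∏ j, eps n (v j) ≠ 0 := Finset.prod_ne_zero_iff.2 fun j _ => eps_ne_zero n _
  have h4 := eps_ne_zero n (v 0)
  have h5 : innerAt (m + 1) (Matrix.of (minkM n))⁻¹ (basisForm v) (v 0) (v 0) =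
    1 / (m.factorial : ℝ) * contr (Matrix.of (minkM n))⁻¹ f f := rfl
  rw [h5, h1]
  have h6 : (m.factorial : ℝ) ≠ 0 := by positivity
  have h7 := h2.ne'
  simp [h3, h4, h6, h7]

/-- The invariant bilinear map `μ₁ ⟨i_−ω, i_−ω⟩ + μ₂ ⟨ω, ω⟩ η`. -/
noncomputable def invariantL (n k : ℕ) (μ₁ μ₂ : ℝ) (a b : Fin (n + 1)) :
    ((Fin k → Fin (n + 1)) → ℝ) →ₗ[ℝ] ((Fin k → Fin (n + 1)) → ℝ) →ₗ[ℝ] ℝ :=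
  (μ₁ * (1 / ((k - 1).factorial : ℝ))) •
      (contrL (Matrix.of (minkM n))⁻¹).compl₁₂ (LinearMap.funLeft ℝ ℝ (dcons k a))
        (LinearMap.funLeft ℝ ℝ (dcons k b)) +
    (μ₂ * minkM n a b * (1 / (k.factorial : ℝ))) • contrL (Matrix.of (minkM n))⁻¹

lemma invariantL_apply (n k : ℕ) (μ₁ μ₂ : ℝ) (a b : Fin (n + 1))
    (w : (Fin k → Fin (n + 1)) → ℝ) : invariantL n k μ₁ μ₂ a b w w =
      μ₁ * innerAt k (Matrix.of (minkM n))⁻¹ w a b +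
        μ₂ * scalarAt k (Matrix.of (minkM n))⁻¹ w * minkM n a b := by
  change μ₁ * (1 / ((k - 1).factorial : ℝ)) * contr (Matrix.of (minkM n))⁻¹
    (fun v => w (dcons k a v)) (fun v => w (dcons k b v)) +
    μ₂ * minkM n a b * (1 / (k.factorial : ℝ)) * contr (Matrix.of (minkM n))⁻¹ w w = _
  simp only [innerAt, scalarAt]
  ring

/-- Lorentz-equivariant quadratic maps from `k`-forms to bilinear forms. -/
theorem IsEquivariant.exists_eq {n k : ℕ} (hk1 : 1 ≤ k) (hk2 : k ≤ n + 1)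
    {B : Fin (n + 1) → Fin (n + 1) →
      ((Fin k → Fin (n + 1)) → ℝ) →ₗ[ℝ] ((Fin k → Fin (n + 1)) → ℝ) →ₗ[ℝ] ℝ}
    (hB : IsEquivariant B) : ∃ μ₁ μ₂ : ℝ, ∀ w, IsAlt w → ∀ a b, B a b w w =
      μ₁ * innerAt k (Matrix.of (minkM n))⁻¹ w a b +
        μ₂ * scalarAt k (Matrix.of (minkM n))⁻¹ w * minkM n a b := by
  set v₀ : Fin k → Fin (n + 1) := Fin.castLE hk2
  have hv₀ : Function.Injective v₀ := Fin.castLE_injective hk2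
  set E := basisForm v₀
  set p := v₀ ⟨0, hk1⟩
  have hii := innerAt_basisForm_ne_zero hk1 hv₀
  have hsc := scalarAt_basisForm_ne_zero hv₀
  obtain ⟨μ₂, h₂⟩ : ∃ μ₂ : ℝ, ∀ c, c ∉ Set.range v₀ → ∃ d ∉ Set.range v₀,
      B d d E E = μ₂ * scalarAt k (Matrix.of (minkM n))⁻¹ E * minkM n d d := by
    by_cases h : ∃ o, o ∉ Set.range v₀
    · obtain ⟨o, ho⟩ := h
      have ho' : minkM n o o ≠ 0 := by simp [minkM, eps_ne_zero]
      refine ⟨B o o E E / (scalarAt k (Matrix.of (minkM n))⁻¹ E * minkM n o o),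
        fun c _ => ⟨o, ho, ?_⟩⟩
      rw [mul_assoc, div_mul_cancel₀ _ (mul_ne_zero hsc ho')]
    · push Not at h
      exact ⟨0, fun c hc => absurd (h c) hc⟩
  obtain ⟨μ₁, h₁⟩ : ∃ μ₁ : ℝ, B p p E E = μ₁ * innerAt k (Matrix.of (minkM n))⁻¹ E p p +
      μ₂ * scalarAt k (Matrix.of (minkM n))⁻¹ E * minkM n p p := by
    refine ⟨(B p p E E - μ₂ * scalarAt k (Matrix.of (minkM n))⁻¹ E * minkM n p p) /
      innerAt k (Matrix.of (minkM n))⁻¹ E p p, ?_⟩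
    rw [div_mul_cancel₀ _ hii]
    ring
  have hD : IsEquivariant fun a b => B a b - invariantL n k μ₁ μ₂ a b := by
    intro M hM w hw a b
    have hinv := transpose_mul_inv_mul (isUnit_det_of_pullB_minkM hM) (minkM n)
    rw [hM] at hinv
    have hη : minkM n a b = pullB M (minkM n) a b := by rw [hM]
    simp only [LinearMap.sub_apply, invariantL_apply]
    rw [hB M hM w hw, innerAt_pullF hk1, scalarAt_pullF, hinv, hη]
    simp only [pullB, Finset.mul_sum, ← Finset.sum_add_distrib, ← Finset.sum_sub_distrib]
    exact Finset.sum_congr rfl fun _ _ => Finset.sum_congr rfl fun _ _ => by ring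
  refine ⟨μ₁, μ₂, fun w hw a b => ?_⟩
  have := hD.eq_zero hv₀ (fun c _ => ⟨p, ⟨_, rfl⟩, ?_⟩) (fun c hc => ?_) hw a b
  · rw [LinearMap.sub_apply, LinearMap.sub_apply, invariantL_apply] at this
    linarith
  · rw [LinearMap.sub_apply, LinearMap.sub_apply, invariantL_apply]
    linarith
  · obtain ⟨d, hd, h⟩ := h₂ c hc
    refine ⟨d, hd, ?_⟩
    rw [LinearMap.sub_apply, LinearMap.sub_apply, invariantL_apply,
      innerAt_basisForm_of_notMem hk1 hd, h]
    ring

lemma IsMetricOn.mono {n : ℕ} {W W' : Set (Pt n)} {g : Pt n → Fin (n + 1) → Fin (n + 1) → ℝ}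
    (hg : IsMetricOn n W g) (h : W' ⊆ W) : IsMetricOn n W' g :=
  ⟨fun a b => (hg.1 a b).mono h, fun x hx => hg.2 x (h hx)⟩

lemma IsFormOn.mono {n k : ℕ} {W W' : Set (Pt n)} {w : Pt n → (Fin k → Fin (n + 1)) → ℝ}
    (hw : IsFormOn n k W w) (h : W' ⊆ W) : IsFormOn n k W' w :=
  ⟨fun v => (hw.1 v).mono h, fun x hx => hw.2 x (h hx)⟩

lemma isMetricOn_const {n : ℕ} (W : Set (Pt n)) {G : Fin (n + 1) → Fin (n + 1) → ℝ}
    (hG : IsLor G) : IsMetricOn n W fun _ => G :=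
  ⟨fun _ _ => contDiffOn_const, fun _ _ => hG⟩

lemma isFormOn_const {n k : ℕ} (W : Set (Pt n)) {w : (Fin k → Fin (n + 1)) → ℝ}
    (hw : IsAlt w) : IsFormOn n k W fun _ => w :=
  ⟨fun _ => contDiffOn_const, fun _ _ => hw⟩

lemma pullTensor_eq {n : ℕ} (τ : Pt n → Pt n) (g : Pt n → Fin (n + 1) → Fin (n + 1) → ℝ)
    (x : Pt n) : pullTensor n τ g x = pullB (Matrix.of (jac n τ x)) (g (τ x)) := rfl

lemma pullForm_eq {n k : ℕ} (τ : Pt n → Pt n) (w : Pt n → (Fin k → Fin (n + 1)) → ℝ)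
    (x : Pt n) : pullForm n k τ w x = pullF (Matrix.of (jac n τ x)) (w (τ x)) := rfl

namespace NaturalTensor

variable {n k : ℕ} (T : NaturalTensor n k)

/-- The value at a point depends only on germs. -/
lemma congr_of_eventuallyEq {W₁ W₂ : Set (Pt n)}
    {g₁ g₂ : Pt n → Fin (n + 1) → Fin (n + 1) → ℝ} {w₁ w₂ : Pt n → (Fin k → Fin (n + 1)) → ℝ}
    (hW₁ : IsOpen W₁) (hW₂ : IsOpen W₂) (hg₁ : IsMetricOn n W₁ g₁) (hw₁ : IsFormOn n k W₁ w₁)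
    (hg₂ : IsMetricOn n W₂ g₂) (hw₂ : IsFormOn n k W₂ w₂) {x : Pt n} (hx₁ : x ∈ W₁)
    (hx₂ : x ∈ W₂) (h : ∀ᶠ y in 𝓝 x, g₁ y = g₂ y ∧ w₁ y = w₂ y) :
    T.T W₁ g₁ w₁ x = T.T W₂ g₂ w₂ x := by
  obtain ⟨V, hV, hVo, hxV⟩ := eventually_nhds_iff.1 h
  have h₁ : W₁ ∩ W₂ ∩ V ⊆ W₁ := fun y hy => hy.1.1
  have ho := (hW₁.inter hW₂).inter hVo
  rw [← T.localize (W₁ ∩ W₂ ∩ V) W₁ g₁ w₁ g₁ w₁ ho hW₁ h₁ (hg₁.mono h₁) (hw₁.mono h₁) hg₁ hw₁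
    (fun _ _ => ⟨rfl, rfl⟩) x ⟨⟨hx₁, hx₂⟩, hxV⟩]
  exact T.localize (W₁ ∩ W₂ ∩ V) W₂ g₁ w₁ g₂ w₂ ho hW₂ (fun y hy => hy.1.2) (hg₁.mono h₁)
    (hw₁.mono h₁) hg₂ hw₂ (fun y hy => hV y hy.2) x ⟨⟨hx₁, hx₂⟩, hxV⟩

end NaturalTensor

/-- The linear map with Jacobian matrix `M`. -/
noncomputable def linMap {n : ℕ} (M : Matrix (Fin (n + 1)) (Fin (n + 1)) ℝ) : Pt n →L[ℝ] Pt n :=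
  LinearMap.toContinuousLinearMap (Matrix.mulVecLin M.transpose)

lemma linMap_apply {n : ℕ} (M : Matrix (Fin (n + 1)) (Fin (n + 1)) ℝ) (x : Pt n) :
    linMap M x = M.transpose.mulVec x := rfl

lemma jac_linMap {n : ℕ} (M : Matrix (Fin (n + 1)) (Fin (n + 1)) ℝ) (x : Pt n) :
    jac n (linMap M) x = M := by
  funext a c
  rw [jac, ContinuousLinearMap.fderiv, linMap_apply]
  simp

lemma isDiffeoOn_linMap {n : ℕ} {M : Matrix (Fin (n + 1)) (Fin (n + 1)) ℝ} (hM : IsUnit M.det)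
    {W : Set (Pt n)} (hW : IsOpen W) :
    IsDiffeoOn n (linMap M) (linMap M⁻¹) (linMap M ⁻¹' W) W := by
  have h1 : ∀ x, linMap M⁻¹ (linMap M x) = x := fun x => by
    rw [linMap_apply, linMap_apply, Matrix.mulVec_mulVec, ← Matrix.transpose_mul,
      Matrix.mul_nonsing_inv _ hM, Matrix.transpose_one, Matrix.one_mulVec]
  have h2 : ∀ x, linMap M (linMap M⁻¹ x) = x := fun x => by
    rw [linMap_apply, linMap_apply, Matrix.mulVec_mulVec, ← Matrix.transpose_mul,
      Matrix.nonsing_inv_mul _ hM, Matrix.transpose_one, Matrix.one_mulVec]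
  exact {
    open_src := hW.preimage (linMap M).continuous
    open_tgt := hW
    mapsTo := fun x hx => hx
    mapsTo_inv := fun y hy => by rwa [Set.mem_preimage, h2]
    left_inv := fun x _ => h1 x
    right_inv := fun y _ => h2 y
    smooth := (linMap M).contDiff.contDiffOn
    smooth_inv := (linMap M⁻¹).contDiff.contDiffOn }

namespace NaturalTensor

variable {n k : ℕ} (T : NaturalTensor n k)

lemma linear {M : Matrix (Fin (n + 1)) (Fin (n + 1)) ℝ} (hM : IsUnit M.det)
    {W : Set (Pt n)} (hW : IsOpen W) {g : Pt n → Fin (n + 1) → Fin (n + 1) → ℝ}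
    {w : Pt n → (Fin k → Fin (n + 1)) → ℝ} (hg : IsMetricOn n W g) (hw : IsFormOn n k W w)
    {x : Pt n} (hx : linMap M x ∈ W) :
    T.T (linMap M ⁻¹' W) (fun y => pullB M (g (linMap M y))) (fun y => pullF M (w (linMap M y))) x
      = pullB M (T.T W g w (linMap M x)) := by
  have := T.natural _ _ _ _ (isDiffeoOn_linMap hM hW) g w hg hw x hx
  funext a b
  have e1 : pullTensor n (linMap M) g = fun y => pullB M (g (linMap M y)) := by
    funext y; rw [pullTensor_eq, jac_linMap]; rfl
  have e2 : pullForm n k (linMap M) w = fun y => pullF M (w (linMap M y)) := by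
    funext y; rw [pullForm_eq, jac_linMap]; rfl
  rw [← e1, ← e2, this, pullTensor_eq, jac_linMap]; rfl

/-- The value of a natural tensor on constant data. -/
def atConst (G : Fin (n + 1) → Fin (n + 1) → ℝ) (w : (Fin k → Fin (n + 1)) → ℝ) :
    Fin (n + 1) → Fin (n + 1) → ℝ :=
  T.T Set.univ (fun _ => G) (fun _ => w) 0

lemma atConst_pull {M : Matrix (Fin (n + 1)) (Fin (n + 1)) ℝ} (hM : IsUnit M.det)
    {G : Fin (n + 1) → Fin (n + 1) → ℝ} (hG : IsLor G) {w : (Fin k → Fin (n + 1)) → ℝ}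
    (hw : IsAlt w) : T.atConst (pullB M G) (pullF M w) = pullB M (T.atConst G w) := by
  have := T.linear hM isOpen_univ (isMetricOn_const _ hG) (isFormOn_const _ hw) (x := 0) trivial
  rw [map_zero] at this
  exact this

/-- Independence of the unit of scale. -/
def ScaleInvariant : Prop :=
  ∀ W g w, IsOpen W → IsMetricOn n W g → IsFormOn n k W w →
      ∀ lam : ℝ, 0 < lam → ∀ x ∈ W, ∀ a b,
        T.T W (fun y c d => lam ^ 2 * g y c d) (fun y v => lam ^ (k - 1) * w y v) x a b
          = T.T W g w x a b

variable {T}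

/-- Dilating the data multiplies the value at the origin by `t²`. -/
lemma ScaleInvariant.dilate (hT : T.ScaleInvariant) (hk : 1 ≤ k) {W W' : Set (Pt n)}
    (hW : IsOpen W) (hW' : IsOpen W') {g g' : Pt n → Fin (n + 1) → Fin (n + 1) → ℝ}
    {w w' : Pt n → (Fin k → Fin (n + 1)) → ℝ} (hg : IsMetricOn n W g) (hw : IsFormOn n k W w)
    (hg' : IsMetricOn n W' g') (hw' : IsFormOn n k W' w') (h0 : 0 ∈ W) (h0' : 0 ∈ W')
    {t : ℝ} (ht : 0 < t)
    (h : ∀ᶠ y in 𝓝 (0 : Pt n), g' y = g (t • y) ∧ w' y = fun v => t * w (t • y) v)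
    (a b : Fin (n + 1)) : T.T W' g' w' 0 a b = t ^ 2 * T.T W g w 0 a b := by
  set M : Matrix (Fin (n + 1)) (Fin (n + 1)) ℝ := t • 1 with hMdef
  have hM : IsUnit M.det := by
    rw [hMdef, Matrix.det_smul, Matrix.det_one, mul_one]
    exact (pow_ne_zero _ ht.ne').isUnit
  have hlin : ∀ y, linMap M y = t • y := fun y => by
    rw [linMap_apply, hMdef, Matrix.transpose_smul, Matrix.transpose_one, Matrix.smul_mulVec,
      Matrix.one_mulVec]
  have hB : ∀ G : Fin (n + 1) → Fin (n + 1) → ℝ, pullB M G = fun c d => t ^ 2 * G c d := by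
    intro G
    funext c d
    simp only [pullB, hMdef, Matrix.smul_apply, Matrix.one_apply, smul_eq_mul]
    simp [pow_two, mul_assoc]
  have hF : ∀ u : (Fin k → Fin (n + 1)) → ℝ, pullF M u = fun v => t ^ (k - 1) * (t * u v) := by
    intro u
    rw [hMdef, pullF_smul_matrix]
    funext v
    rw [← mul_assoc, ← pow_succ, Nat.sub_add_cancel hk]
  have hVo : IsOpen (linMap M ⁻¹' W) := hW.preimage (linMap M).continuous
  have h0V : (0 : Pt n) ∈ linMap M ⁻¹' W := by simpa using h0
  have hgV : IsMetricOn n (linMap M ⁻¹' W) fun y => g (linMap M y) :=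
    ⟨fun c d => (hg.1 c d).comp (linMap M).contDiff.contDiffOn fun y hy => hy,
      fun y hy => hg.2 _ hy⟩
  have hwV : IsFormOn n k (linMap M ⁻¹' W) fun y v => t * w (linMap M y) v :=
    ⟨fun v => contDiffOn_const.mul
      ((hw.1 v).comp (linMap M).contDiff.contDiffOn fun y hy => hy),
      fun y hy => IsAlt.smul (hw.2 _ hy) t⟩
  have h1 := T.linear hM hW hg hw (x := 0) h0V
  rw [map_zero] at h1
  simp only [hB, hF] at h1
  have h2 := hT _ _ _ hVo hgV hwV t ht 0 h0V a b
  rw [h1] at h2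
  refine Eq.trans ?_ h2.symm
  refine congrFun (congrFun (T.congr_of_eventuallyEq hW' hVo hg' hw' hgV hwV h0' h0V ?_) a) b
  filter_upwards [h] with y hy
  simpa only [hlin] using hy

end NaturalTensor

namespace NaturalTensor

variable {n k : ℕ} {T : NaturalTensor n k}

lemma ScaleInvariant.atConst_smul (hT : T.ScaleInvariant) (hk : 1 ≤ k)
    {G : Fin (n + 1) → Fin (n + 1) → ℝ} (hG : IsLor G) {w : (Fin k → Fin (n + 1)) → ℝ}
    (hw : IsAlt w) {t : ℝ} (ht : 0 < t) (a b : Fin (n + 1)) :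
    T.atConst G (fun v => t * w v) a b = t ^ 2 * T.atConst G w a b :=
  hT.dilate hk isOpen_univ isOpen_univ (isMetricOn_const _ hG) (isFormOn_const _ hw)
    (isMetricOn_const _ hG) (isFormOn_const _ (hw.smul t)) trivial trivial ht
    (Filter.Eventually.of_forall fun _ => ⟨rfl, rfl⟩) a b

/-- On constant data the tensor is a quadratic function of the form. -/
lemma ScaleInvariant.exists_bilinear (hT : T.ScaleInvariant) (hk : 1 ≤ k)
    {G : Fin (n + 1) → Fin (n + 1) → ℝ} (hG : IsLor G) :
    ∃ B : Fin (n + 1) → Fin (n + 1) →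
      ((Fin k → Fin (n + 1)) → ℝ) →ₗ[ℝ] ((Fin k → Fin (n + 1)) → ℝ) →ₗ[ℝ] ℝ,
      ∀ w, IsAlt w → ∀ a b, B a b w w = T.atConst G w a b := by
  let e := (Fintype.equivFin (Fin k → Fin (n + 1))).symm
  let N := Fintype.card (Fin k → Fin (n + 1))
  let S : (Fin N → ℝ) → (Fin k → Fin (n + 1)) → ℝ := fun s =>
    ∑ v, ((k.factorial : ℝ)⁻¹ * s (e.symm v)) • basisForm v
  have hSalt : ∀ s, IsAlt (S s) := fun s v σ => by
    simp only [S, Finset.sum_apply, Pi.smul_apply, smul_eq_mul, Finset.mul_sum]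
    refine Finset.sum_congr rfl fun u _ => ?_
    rw [isAlt_basisForm u v σ]
    ring
  have hSsmul : ∀ (t : ℝ) s, S (t • s) = fun v => t * S s v := fun t s => by
    funext v
    simp only [S, Finset.sum_apply, Pi.smul_apply, smul_eq_mul, Finset.mul_sum]
    exact Finset.sum_congr rfl fun u _ => by ring
  have hsm : ∀ a b, ContDiff ℝ (⊤ : ℕ∞) fun s => T.atConst G (S s) a b := by
    intro a b
    have := T.regular N Set.univ Set.univ isOpen_univ isOpen_univ (fun _ _ => G)
      (fun s _ => S s) (fun _ _ => contDiffOn_const) (fun v => ?_)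
      (fun s _ => ⟨isMetricOn_const _ hG, isFormOn_const _ (hSalt s)⟩) a b
    · rw [Set.univ_prod_univ, contDiffOn_univ] at this
      exact this.comp (contDiff_id.prodMk contDiff_const)
    · refine ContDiff.contDiffOn ?_
      simp only [S, Finset.sum_apply, Pi.smul_apply, smul_eq_mul]
      refine ContDiff.sum fun u _ => ContDiff.mul (contDiff_const.mul ?_) contDiff_const
      exact (contDiff_apply ℝ ℝ (e.symm u)).comp contDiff_fst
  let D : Fin (n + 1) → Fin (n + 1) → (Fin N → ℝ) →L[ℝ] (Fin N → ℝ) →L[ℝ] ℝ := fun a b =>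
    fderiv ℝ (fderiv ℝ fun s => T.atConst G (S s) a b) 0
  let R := LinearMap.funLeft ℝ ℝ e
  refine ⟨fun a b => LinearMap.mk₂ ℝ (fun w u => 1 / 2 * D a b (R w) (R u))
    (fun w w' u => by simp [mul_add]) (fun c w u => by simp; ring)
    (fun w u u' => by simp [mul_add]) (fun c w u => by simp; ring), fun w hw a b => ?_⟩
  have key := two_mul_eq_of_homogeneous (fun s => T.atConst G (S s) a b)
    (contDiff_infty.1 (hsm a b) 2).contDiffAt (R w) fun t ht _ => by
      rw [hSsmul, hT.atConst_smul hk hG (hSalt _) ht]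
  have hSw : S (R w) = w := by
    conv_rhs => rw [hw.eq_sum_basisForm]
    simp [S, R, LinearMap.funLeft_apply]
  rw [hSw] at key
  change 1 / 2 * D a b (R w) (R w) = _
  linarith

/-- The values on constant data. -/
theorem ScaleInvariant.exists_atConst_eq (hT : T.ScaleInvariant) (hk1 : 1 ≤ k)
    (hk2 : k ≤ n + 1) : ∃ μ₁ μ₂ : ℝ, ∀ G, IsLor G → ∀ w, IsAlt w → ∀ a b, T.atConst G w a b =
      μ₁ * innerAt k (Matrix.of G)⁻¹ w a b + μ₂ * scalarAt k (Matrix.of G)⁻¹ w * G a b := by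
  obtain ⟨B, hB⟩ := hT.exists_bilinear hk1 (isLor_minkM n)
  have hequiv : IsEquivariant B := fun M hM w hw a b => by
    have h := T.atConst_pull (isUnit_det_of_pullB_minkM hM) (isLor_minkM n) hw
    rw [hM] at h
    rw [hB _ (hw.pullF M), h]
    congr 1
    funext c d
    exact (hB w hw c d).symm
  obtain ⟨μ₁, μ₂, h⟩ := hequiv.exists_eq hk1 hk2
  refine ⟨μ₁, μ₂, fun G hG w hw a b => ?_⟩
  obtain ⟨-, M, hM, hMG⟩ := (isLor_iff G).1 hG
  obtain ⟨M', hM', hM'G⟩ : ∃ M', IsUnit (Matrix.det M') ∧ pullB M' (minkM n) = G :=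
    ⟨M⁻¹, Matrix.isUnit_nonsing_inv_det _ hM, by
      rw [← hMG, pullB_pullB, Matrix.nonsing_inv_mul _ hM, pullB_one]⟩
  obtain ⟨u, hu, rfl⟩ : ∃ u, IsAlt u ∧ pullF M' u = w :=
    ⟨pullF M'⁻¹ w, hw.pullF _, by
      rw [pullF_pullF, Matrix.mul_nonsing_inv _ hM', pullF_one]⟩
  have hinv := transpose_mul_inv_mul hM' (minkM n)
  rw [hM'G] at hinv
  have hη : G a b = pullB M' (minkM n) a b := by rw [hM'G]
  rw [innerAt_pullF hk1, scalarAt_pullF, hinv, hη, ← hM'G,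
    T.atConst_pull hM' (isLor_minkM n) hu]
  have hu' : T.atConst (minkM n) u = fun a b => _ := funext₂ fun a b =>
    ((hB u hu a b).symm.trans (h u hu a b))
  rw [hu']
  simp only [pullB, Finset.mul_sum, ← Finset.sum_add_distrib]
  exact Finset.sum_congr rfl fun _ _ => Finset.sum_congr rfl fun _ _ => by ring

end NaturalTensor

lemma add_eq_of_quadratic {E : Type*} [NormedAddCommGroup E] [NormedSpace ℝ E] {f : E → ℝ}
    {s : Set E} (D : E →L[ℝ] E →L[ℝ] ℝ) (hf : ∀ x ∈ s, 2 * f x = D x x) {x y z : E}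
    (hx : x ∈ s) (hy : y ∈ s) (hz : z ∈ s) (hxy : x + y ∈ s) (hyz : y + z ∈ s) (hxz : x + z ∈ s)
    (hxyz : x + y + z ∈ s) :
    f (x + y + z) + f x + f y + f z = f (x + y) + f (y + z) + f (x + z) := by
  have h1 := hf _ hx
  have h2 := hf _ hy
  have h3 := hf _ hz
  have h4 := hf _ hxy
  have h5 := hf _ hyz
  have h6 := hf _ hxz
  have h7 := hf _ hxyz
  simp only [map_add, _root_.add_apply] at h4 h5 h6 h7
  linarith

/-- First-order Taylor expansion with symmetric coefficients of a metric. -/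
lemma IsMetricOn.exists_expansion {n : ℕ} {W : Set (Pt n)} (hW : IsOpen W) (h0 : 0 ∈ W)
    {g : Pt n → Fin (n + 1) → Fin (n + 1) → ℝ} (hg : IsMetricOn n W g)
    (hd : ∀ a b, fderiv ℝ (fun x => g x a b) 0 = 0) :
    ∃ κ : Fin (n + 1) → Fin (n + 1) → Fin (n + 1) → Pt n → ℝ,
      (∀ a b i, ContDiff ℝ (⊤ : ℕ∞) (κ a b i)) ∧ (∀ a b i y, κ a b i y = κ b a i y) ∧
      (∀ a b i, κ a b i 0 = 0) ∧
      ∀ᶠ x in 𝓝 0, ∀ a b, g x a b = g 0 a b + ∑ i, x i * κ a b i x := by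
  choose κ h1 h2 h3 using fun a b =>
    exists_hadamard_of_contDiffOn hW h0 (fun x => g x a b) (hg.1 a b)
  refine ⟨fun a b i y => 1 / 2 * (κ a b i y + κ b a i y),
    fun a b i => contDiff_const.mul ((h1 a b i).add (h1 b a i)), fun a b i y => by ring,
    fun a b i => ?_, ?_⟩
  · simp [h3, hd]
  · filter_upwards [hW.mem_nhds h0, Filter.eventually_all.2 fun a => Filter.eventually_all.2 (h2 a)]
      with x hx h a b
    have e1 := h a b
    have e2 := h b a
    rw [(hg.2 x hx).1 b a, (hg.2 0 h0).1 b a] at e2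
    have : ∑ i, x i * (1 / 2 * (κ a b i x + κ b a i x)) =
        1 / 2 * (∑ i, x i * κ a b i x + ∑ i, x i * κ b a i x) := by
      rw [← Finset.sum_add_distrib, Finset.mul_sum]
      exact Finset.sum_congr rfl fun _ _ => by ring
    rw [this]
    linarith

namespace NaturalTensor

variable {n k : ℕ}

/-- The tensor vanishes at the zeros of the form. -/
def VanishesWithForm (T : NaturalTensor n k) : Prop :=
  ∀ W g w, IsOpen W → IsMetricOn n W g → IsFormOn n k W w →
      ∀ x ∈ W, (∀ v, w x v = 0) → ∀ a b, T.T W g w x a b = 0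

variable {T : NaturalTensor n k}

/-- If the metric is constant to first order, the tensor only depends on the values of the data
at the point. -/
lemma ScaleInvariant.eq_atConst_of_fderiv_eq_zero (hT : T.ScaleInvariant)
    (hv : T.VanishesWithForm) (hk : 1 ≤ k) {W : Set (Pt n)} (hW : IsOpen W) (h0 : 0 ∈ W)
    {g : Pt n → Fin (n + 1) → Fin (n + 1) → ℝ} {w : Pt n → (Fin k → Fin (n + 1)) → ℝ}
    (hg : IsMetricOn n W g) (hw : IsFormOn n k W w)
    (hd : ∀ a b, fderiv ℝ (fun x => g x a b) 0 = 0) (a b : Fin (n + 1)) :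
    T.T W g w 0 a b = T.atConst (g 0) (w 0) a b := by
  obtain ⟨κ, hκ, hκsymm, hκ0, hexp⟩ := hg.exists_expansion hW h0 hd
  let Ψ : Pt n × Pt n → Fin (n + 1) → Fin (n + 1) → ℝ := fun q a b =>
    g 0 a b + ∑ i, q.1 i * κ a b i q.2
  have hΨsmooth : ∀ a b, ContDiff ℝ (⊤ : ℕ∞) fun q => Ψ q a b := fun a b =>
    contDiff_const.add (ContDiff.sum fun i _ =>
      ((contDiff_apply ℝ ℝ i).comp contDiff_fst).mul ((hκ a b i).comp contDiff_snd))
  have hΨ0 : ∀ y, Ψ (0, y) = g 0 := fun y => by funext a b; simp [Ψ]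
  have hΨ0' : ∀ x, Ψ (x, 0) = g 0 := fun x => by funext a b; simp [Ψ, hκ0]
  have hΨsymm : ∀ q a b, Ψ q a b = Ψ q b a := fun q a b => by
    simp only [Ψ, (hg.2 0 h0).1 a b, hκsymm a b]
  have hΨlor : ∀ᶠ q in 𝓝 (0 : Pt n × Pt n), IsLor (Ψ q) := by
    have hc : Continuous Ψ := continuous_pi fun a => continuous_pi fun b =>
      (hΨsmooth a b).continuous
    have h1 := hc.tendsto 0
    rw [show Ψ 0 = g 0 from hΨ0 0] at h1
    filter_upwards [h1.eventually (IsLor.eventually (hg.2 0 h0))] with q hq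
    exact hq (hΨsymm q)
  obtain ⟨r, hr, hball⟩ : ∃ r > 0, Metric.ball (0 : Pt n) r ⊆ W ∧
      ∀ x ∈ Metric.ball (0 : Pt n) r, ∀ y ∈ Metric.ball (0 : Pt n) r, IsLor (Ψ (x, y)) := by
    obtain ⟨r₁, hr₁, h₁⟩ := Metric.mem_nhds_iff.1 (hW.mem_nhds h0)
    obtain ⟨r₂, hr₂, h₂⟩ := Metric.eventually_nhds_iff_ball.1 hΨlor
    refine ⟨min r₁ r₂, lt_min hr₁ hr₂, (Metric.ball_subset_ball (min_le_left _ _)).trans h₁,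
      fun x hx y hy => h₂ _ ?_⟩
    rw [show (0 : Pt n × Pt n) = (0, 0) from rfl, ← ball_prod_same]
    exact ⟨Metric.ball_subset_ball (min_le_right _ _) hx,
      Metric.ball_subset_ball (min_le_right _ _) hy⟩
  obtain ⟨hrW, hlor⟩ := hball
  set U := Metric.ball (0 : Pt n) r with hU
  set P := Metric.ball (0 : Fin 3 → ℝ) 1 with hP
  have hUo : IsOpen U := Metric.isOpen_ball
  have h0U : (0 : Pt n) ∈ U := Metric.mem_ball_self hr
  have hsmul : ∀ p ∈ P, ∀ i, ∀ x ∈ U, p i • x ∈ U := by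
    intro p hp i x hx
    rw [hU, mem_ball_zero_iff] at hx ⊢
    rw [hP, mem_ball_zero_iff] at hp
    rw [norm_smul]
    have := (norm_le_pi_norm p i).trans hp.le
    nlinarith [norm_nonneg x]
  let gp : (Fin 3 → ℝ) → Pt n → Fin (n + 1) → Fin (n + 1) → ℝ := fun p x =>
    Ψ (p 0 • x, p 1 • x)
  let wp : (Fin 3 → ℝ) → Pt n → (Fin k → Fin (n + 1)) → ℝ := fun p x v =>
    p 2 * w 0 v + p 0 * (w (p 1 • x) v - w 0 v)
  have hcoord : ∀ i, ContDiff ℝ (⊤ : ℕ∞) fun q : (Fin 3 → ℝ) × Pt n => q.1 i := fun i =>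
    (contDiff_apply ℝ ℝ i).comp contDiff_fst
  have hgp_smooth : ∀ a b, ContDiffOn ℝ (⊤ : ℕ∞)
      (fun q : (Fin 3 → ℝ) × Pt n => gp q.1 q.2 a b) (P ×ˢ U) := fun a b =>
    ((hΨsmooth a b).comp (((hcoord 0).smul contDiff_snd).prodMk
      ((hcoord 1).smul contDiff_snd))).contDiffOn
  have hwp_smooth : ∀ v, ContDiffOn ℝ (⊤ : ℕ∞)
      (fun q : (Fin 3 → ℝ) × Pt n => wp q.1 q.2 v) (P ×ˢ U) := fun v =>
    ((hcoord 2).contDiffOn.mul contDiffOn_const).add ((hcoord 0).contDiffOn.mul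
      (((hw.1 v).comp ((hcoord 1).smul contDiff_snd).contDiffOn
        fun q hq => hrW (hsmul _ hq.1 1 _ hq.2)).sub contDiffOn_const))
  have hdata : ∀ p ∈ P, IsMetricOn n U (gp p) ∧ IsFormOn n k U (wp p) := fun p hp =>
    ⟨⟨fun a b => (hgp_smooth a b).comp (contDiff_const.prodMk contDiff_id).contDiffOn
        fun x hx => ⟨hp, hx⟩,
      fun x hx => hlor _ (hsmul p hp 0 x hx) _ (hsmul p hp 1 x hx)⟩,
     ⟨fun v => (hwp_smooth v).comp (contDiff_const.prodMk contDiff_id).contDiffOn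
        fun x hx => ⟨hp, hx⟩,
      fun x hx v σ => by
        have e1 := hw.2 0 h0 v σ
        have e2 := hw.2 _ (hrW (hsmul p hp 1 x hx)) v σ
        simp only [wp, e1, e2]
        ring⟩⟩
  let f : (Fin 3 → ℝ) → ℝ := fun p => T.T U (gp p) (wp p) 0 a b
  have hf : ContDiffAt ℝ 2 f 0 := by
    have h1 := T.regular 3 P U Metric.isOpen_ball hUo gp wp hgp_smooth hwp_smooth hdata a b
    have h2 : ContDiffOn ℝ (⊤ : ℕ∞) f P :=
      h1.comp (contDiff_id.prodMk contDiff_const).contDiffOn fun p hp => ⟨hp, h0U⟩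
    exact (contDiffOn_infty.1 h2 2).contDiffAt (Metric.ball_mem_nhds _ one_pos)
  have hquad : ∀ p ∈ P, 2 * f p = fderiv ℝ (fderiv ℝ f) 0 p p := by
    intro p hp
    refine two_mul_eq_of_homogeneous f hf p fun t ht ht1 => ?_
    have htp : t • p ∈ P := by
      rw [hP, mem_ball_zero_iff] at hp ⊢
      rw [norm_smul, Real.norm_of_nonneg ht.le]
      nlinarith [norm_nonneg p]
    refine hT.dilate hk hUo hUo (hdata p hp).1 (hdata p hp).2 (hdata _ htp).1 (hdata _ htp).2
      h0U h0U ht (Filter.Eventually.of_forall fun y => ⟨?_, ?_⟩) a b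
    · simp only [gp, Pi.smul_apply, smul_eq_mul, smul_smul, mul_comm t]
    · funext v
      simp only [wp, Pi.smul_apply, smul_eq_mul, smul_smul, mul_comm t]
      ring
  have hmem : ∀ x y z : ℝ, |x| < 1 → |y| < 1 → |z| < 1 → ![x, y, z] ∈ P := by
    intro x y z hx hy hz
    rw [hP, mem_ball_zero_iff, pi_norm_lt_iff one_pos]
    intro i
    fin_cases i <;> simpa
  have hhalf : |(1 / 2 : ℝ)| < 1 := by norm_num [abs_of_pos]
  have hzero : |(0 : ℝ)| < 1 := by norm_num
  have key := add_eq_of_quadratic _ hquad (x := ![1 / 2, 0, 0]) (y := ![0, 1 / 2, 0])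
    (z := ![0, 0, 1 / 2]) (hmem _ _ _ hhalf hzero hzero) (hmem _ _ _ hzero hhalf hzero)
    (hmem _ _ _ hzero hzero hhalf) (by simpa using hmem _ _ _ hhalf hhalf hzero)
    (by simpa using hmem _ _ _ hzero hhalf hhalf) (by simpa using hmem _ _ _ hhalf hzero hhalf)
    (by simpa using hmem _ _ _ hhalf hhalf hhalf)
  have hvan : ∀ x y, |x| < 1 → |y| < 1 → f ![x, y, 0] = 0 := fun x y hx hy => by
    obtain ⟨h1, h2⟩ := hdata _ (hmem x y 0 hx hy hzero)
    exact hv U _ _ hUo h1 h2 0 h0U (fun v => by simp [wp]) a b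
  have hconst : ∀ x y, x * y = 0 → |x| < 1 → |y| < 1 →
      f ![x, y, 1 / 2] = (1 / 2) ^ 2 * T.atConst (g 0) (w 0) a b := fun x y hxy hx hy => by
    obtain ⟨h1, h2⟩ := hdata _ (hmem x y _ hx hy hhalf)
    refine hT.dilate hk isOpen_univ hUo (isMetricOn_const _ (hg.2 0 h0))
      (isFormOn_const _ (hw.2 0 h0)) h1 h2 trivial h0U one_half_pos
      (Filter.Eventually.of_forall fun z => ?_) a b
    rcases mul_eq_zero.1 hxy with rfl | rfl
    · exact ⟨by simp [gp, hΨ0], by funext v; simp [wp]⟩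
    · exact ⟨by simp [gp, hΨ0'], by funext v; simp [wp]⟩
  have hfull : f ![1 / 2, 1 / 2, 1 / 2] = (1 / 2) ^ 2 * T.T W g w 0 a b := by
    obtain ⟨h1, h2⟩ := hdata _ (hmem _ _ _ hhalf hhalf hhalf)
    refine hT.dilate hk hW hUo hg hw h1 h2 h0 h0U one_half_pos ?_ a b
    have hlim : Filter.Tendsto (fun y : Pt n => (1 / 2 : ℝ) • y) (𝓝 0) (𝓝 0) := by
      have : Continuous fun y : Pt n => (1 / 2 : ℝ) • y := by fun_prop
      simpa using this.tendsto 0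
    filter_upwards [hlim.eventually hexp] with y hy
    refine ⟨?_, ?_⟩
    · funext c d
      exact (hy c d).symm
    · funext v
      simp only [wp, Matrix.cons_val]
      ring
  have e1 : (![1 / 2, 0, 0] + ![0, 1 / 2, 0] + ![0, 0, 1 / 2] : Fin 3 → ℝ) =
    ![1 / 2, 1 / 2, 1 / 2] := by simp
  have e2 : (![1 / 2, 0, 0] + ![0, 1 / 2, 0] : Fin 3 → ℝ) = ![1 / 2, 1 / 2, 0] := by simp
  have e3 : (![0, 1 / 2, 0] + ![0, 0, 1 / 2] : Fin 3 → ℝ) = ![0, 1 / 2, 1 / 2] := by simp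
  have e4 : (![1 / 2, 0, 0] + ![0, 0, 1 / 2] : Fin 3 → ℝ) = ![1 / 2, 0, 1 / 2] := by simp
  rw [e1, e2, e3, e4, hfull, hvan _ _ hhalf hzero, hvan _ _ hzero hhalf, hvan _ _ hhalf hhalf,
    hconst 0 0 (by simp) hzero hzero, hconst 0 (1 / 2) (by simp) hzero hhalf,
    hconst (1 / 2) 0 (by simp) hhalf hzero] at key
  linarith

end NaturalTensor

lemma fderiv_eq_linMap {n : ℕ} (τ : Pt n → Pt n) (x : Pt n) :
    fderiv ℝ τ x = linMap (Matrix.of (jac n τ x)) := by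
  refine ContinuousLinearMap.coe_injective (LinearMap.pi_ext' fun a => LinearMap.ext_ring ?_)
  funext c
  simp [linMap_apply, jac]

lemma contDiff_jac {n : ℕ} {τ : Pt n → Pt n} (hτ : ContDiff ℝ (⊤ : ℕ∞) τ)
    (a c : Fin (n + 1)) : ContDiff ℝ (⊤ : ℕ∞) fun x => jac n τ x a c :=
  (contDiff_apply ℝ ℝ c).comp ((hτ.fderiv_right le_rfl).clm_apply contDiff_const)

/-- The inverse function theorem for smooth maps, in terms of `IsDiffeoOn`. -/
lemma exists_isDiffeoOn {n : ℕ} {τ : Pt n → Pt n} (hτ : ContDiff ℝ (⊤ : ℕ∞) τ) {x : Pt n}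
    (hx : IsUnit (Matrix.of (jac n τ x)).det) {W : Set (Pt n)} (hW : IsOpen W) (hxW : τ x ∈ W) :
    ∃ U σf, x ∈ U ∧ IsDiffeoOn n τ σf U (τ '' U) ∧ τ '' U ⊆ W ∧
      ∀ y ∈ U, IsUnit (Matrix.of (jac n τ y)).det := by
  have hequiv : ∀ y, IsUnit (Matrix.of (jac n τ y)).det →
      ∃ F : Pt n ≃L[ℝ] Pt n, HasFDerivAt τ (F : Pt n →L[ℝ] Pt n) y := by
    intro y hy
    have hd := isDiffeoOn_linMap hy isOpen_univ
    refine ⟨ContinuousLinearEquiv.equivOfInverse (linMap (Matrix.of (jac n τ y)))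
      (linMap (Matrix.of (jac n τ y))⁻¹) (fun z => hd.left_inv z trivial)
      (fun z => hd.right_inv z trivial), ?_⟩
    have h1 := (hτ.differentiable (by simp) y).hasFDerivAt
    rw [fderiv_eq_linMap] at h1
    exact h1
  obtain ⟨F, hF⟩ := hequiv x hx
  have htop : ((⊤ : ℕ∞) : WithTop ℕ∞) ≠ 0 := by simp
  let e := hτ.contDiffAt.toOpenPartialHomeomorph τ hF htop
  have hxe : x ∈ e.source := hτ.contDiffAt.mem_toOpenPartialHomeomorph_source hF htop
  have hdet : Continuous fun y => (Matrix.of (jac n τ y)).det :=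
    Continuous.matrix_det <| continuous_pi fun a => continuous_pi fun c =>
      (contDiff_jac hτ a c).continuous
  have hDo : IsOpen {y | (Matrix.of (jac n τ y)).det ≠ 0} := isOpen_ne.preimage hdet
  set U := e.source ∩ (τ ⁻¹' W ∩ {y | (Matrix.of (jac n τ y)).det ≠ 0}) with hU
  have hUe : U ⊆ e.source := fun y hy => hy.1
  have hUo : IsOpen U := e.open_source.inter ((hW.preimage hτ.continuous).inter hDo)
  have hleft : ∀ y ∈ U, e.symm (τ y) = y := fun y hy => e.left_inv (hUe hy)
  refine ⟨U, e.symm, ⟨hxe, hxW, hx.ne_zero⟩, ?_, ?_, fun y hy => hy.2.2.isUnit⟩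
  · exact {
      open_src := hUo
      open_tgt := e.isOpen_image_of_subset_source hUo hUe
      mapsTo := Set.mapsTo_image τ U
      mapsTo_inv := by
        rintro _ ⟨y, hy, rfl⟩
        rwa [hleft y hy]
      left_inv := hleft
      right_inv := by
        rintro _ ⟨y, hy, rfl⟩
        rw [hleft y hy]
      smooth := hτ.contDiffOn
      smooth_inv := by
        rintro _ ⟨y, hy, rfl⟩
        obtain ⟨F', hF'⟩ := hequiv y hy.2.2.isUnit
        have hy' : e.symm (τ y) = y := hleft y hy
        exact (e.contDiffAt_symm (e.map_source (hUe hy)) (hy'.symm ▸ hF' :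
          HasFDerivAt τ (F' : Pt n →L[ℝ] Pt n) (e.symm (τ y))) hτ.contDiffAt).contDiffWithinAt }
  · rintro _ ⟨y, hy, rfl⟩
    exact hy.2.1

lemma IsMetricOn.pullTensor {n : ℕ} {τ : Pt n → Pt n} (hτ : ContDiff ℝ (⊤ : ℕ∞) τ)
    {U W : Set (Pt n)} (hU : Set.MapsTo τ U W)
    (hdet : ∀ y ∈ U, IsUnit (Matrix.of (jac n τ y)).det)
    {g : Pt n → Fin (n + 1) → Fin (n + 1) → ℝ} (hg : IsMetricOn n W g) :
    IsMetricOn n U (pullTensor n τ g) :=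
  ⟨fun a b => ContDiffOn.sum fun c _ => ContDiffOn.sum fun d _ =>
      ((contDiff_jac hτ a c).mul (contDiff_jac hτ b d)).contDiffOn.mul
        ((hg.1 c d).comp hτ.contDiffOn hU),
    fun y hy => IsLor.pullB (hg.2 _ (hU hy)) (hdet y hy)⟩

lemma IsFormOn.pullForm {n k : ℕ} {τ : Pt n → Pt n} (hτ : ContDiff ℝ (⊤ : ℕ∞) τ)
    {U W : Set (Pt n)} (hU : Set.MapsTo τ U W)
    {w : Pt n → (Fin k → Fin (n + 1)) → ℝ} (hw : IsFormOn n k W w) :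
    IsFormOn n k U (pullForm n k τ w) :=
  ⟨fun v => ContDiffOn.sum fun u _ =>
      (contDiff_prod fun j _ => contDiff_jac hτ (v j) (u j)).contDiffOn.mul
        ((hw.1 u).comp hτ.contDiffOn hU),
    fun _ hy => IsAlt.pullF (hw.2 _ (hU hy)) _⟩

/-- The map `y ↦ x₀ + y - ½ Γ(y,y)`. -/
noncomputable def quadMap {n : ℕ} (x₀ : Pt n) (Γ : Fin (n + 1) → Fin (n + 1) → Fin (n + 1) → ℝ)
    (y : Pt n) : Pt n :=
  fun c => x₀ c + y c - 1 / 2 * ∑ a, ∑ b, Γ c a b * (y a * y b)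

lemma quadMap_zero {n : ℕ} (x₀ : Pt n) (Γ : Fin (n + 1) → Fin (n + 1) → Fin (n + 1) → ℝ) :
    quadMap x₀ Γ 0 = x₀ := by
  funext c
  simp [quadMap]

lemma contDiff_quadMap {n : ℕ} (x₀ : Pt n) (Γ : Fin (n + 1) → Fin (n + 1) → Fin (n + 1) → ℝ) :
    ContDiff ℝ (⊤ : ℕ∞) (quadMap x₀ Γ) := by
  unfold quadMap
  fun_prop

lemma jac_quadMap {n : ℕ} (x₀ : Pt n) {Γ : Fin (n + 1) → Fin (n + 1) → Fin (n + 1) → ℝ}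
    (hΓ : ∀ c a b, Γ c a b = Γ c b a) (y : Pt n) (a c : Fin (n + 1)) :
    jac n (quadMap x₀ Γ) y a c = (1 : Matrix _ _ ℝ) a c - ∑ b, Γ c a b * y b := by
  have hp : ∀ i, HasFDerivAt (fun y : Pt n => y i) (ContinuousLinearMap.proj i : Pt n →L[ℝ] ℝ) y :=
    fun i => (ContinuousLinearMap.proj i : Pt n →L[ℝ] ℝ).hasFDerivAt
  have h := ((hp c).const_add (x₀ c)).sub ((HasFDerivAt.fun_sum fun a (_ : a ∈ Finset.univ) =>
    HasFDerivAt.fun_sum fun b (_ : b ∈ Finset.univ) =>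
      ((hp a).mul (hp b)).const_mul (Γ c a b)).const_mul (1 / 2))
  have h2 := (hasFDerivAt_pi'.1
    ((contDiff_quadMap x₀ Γ).differentiable (by simp) y).hasFDerivAt c).unique h
  have h3 := congrArg (fun L => L (Pi.single a 1)) h2
  rw [jac]
  refine Eq.trans h3 ?_
  simp [Pi.single_apply, Finset.sum_add_distrib, Matrix.one_apply, hΓ c _ a, eq_comm (a := c)]
  ring

lemma IsMetricOn.pd_symm {n : ℕ} {W : Set (Pt n)} (hW : IsOpen W)
    {g : Pt n → Fin (n + 1) → Fin (n + 1) → ℝ} (hg : IsMetricOn n W g) {x : Pt n} (hx : x ∈ W)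
    (e a b : Fin (n + 1)) : pd n e (fun y => g y a b) x = pd n e (fun y => g y b a) x := by
  have : (fun y => g y a b) =ᶠ[𝓝 x] fun y => g y b a := by
    filter_upwards [hW.mem_nhds hx] with y hy using (hg.2 y hy).1 a b
  rw [pd, pd, this.fderiv_eq]

lemma IsMetricOn.christoffel_symm {n : ℕ} {W : Set (Pt n)} (hW : IsOpen W)
    {g : Pt n → Fin (n + 1) → Fin (n + 1) → ℝ} (hg : IsMetricOn n W g) {x : Pt n} (hx : x ∈ W)
    (c a b : Fin (n + 1)) : christoffel n g x c a b = christoffel n g x c b a := by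
  simp only [christoffel]
  congr 1
  refine Finset.sum_congr rfl fun d _ => ?_
  rw [hg.pd_symm hW hx d a b]
  ring

lemma IsMetricOn.sum_mul_christoffel {n : ℕ} {W : Set (Pt n)}
    {g : Pt n → Fin (n + 1) → Fin (n + 1) → ℝ} (hg : IsMetricOn n W g) {x : Pt n} (hx : x ∈ W)
    (d a b : Fin (n + 1)) : ∑ c, g x d c * christoffel n g x c a b =
      1 / 2 * (pd n a (fun y => g y d b) x + pd n b (fun y => g y d a) x
        - pd n d (fun y => g y a b) x) := by
  set v : Pt n := fun d => pd n a (fun y => g y d b) x + pd n b (fun y => g y d a) x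
        - pd n d (fun y => g y a b) x with hv
  have h1 : (fun c => christoffel n g x c a b) = (1 / 2 : ℝ) • (ginv n g x).mulVec v := by
    funext c
    simp [christoffel, Matrix.mulVec, dotProduct, hv]
  have h2 : (Matrix.of (g x)).mulVec (fun c => christoffel n g x c a b) = (1 / 2 : ℝ) • v := by
    rw [h1, Matrix.mulVec_smul, Matrix.mulVec_mulVec, ginv,
      Matrix.mul_nonsing_inv _ (IsLor.isUnit_det (hg.2 x hx)), Matrix.one_mulVec]
  exact congrFun h2 d

/-- In the coordinates given by `quadMap`, the metric is constant to first order. -/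
lemma IsMetricOn.fderiv_pullTensor_quadMap {n : ℕ} {W : Set (Pt n)} (hW : IsOpen W)
    {g : Pt n → Fin (n + 1) → Fin (n + 1) → ℝ} (hg : IsMetricOn n W g) {x : Pt n} (hx : x ∈ W)
    (a b : Fin (n + 1)) :
    fderiv ℝ (fun y => Paper.pullTensor n (quadMap x (christoffel n g x)) g y a b) 0 = 0 := by
  set Γ := christoffel n g x with hΓ
  have hsymm : ∀ c a b, Γ c a b = Γ c b a := hg.christoffel_symm hW hx
  have hp : ∀ i, HasFDerivAt (fun y : Pt n => y i) (ContinuousLinearMap.proj i : Pt n →L[ℝ] ℝ) 0 :=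
    fun i => (ContinuousLinearMap.proj i : Pt n →L[ℝ] ℝ).hasFDerivAt
  have hJ : ∀ a c, HasFDerivAt (fun y => jac n (quadMap x Γ) y a c)
      (-∑ e, Γ c a e • (ContinuousLinearMap.proj e : Pt n →L[ℝ] ℝ)) 0 := by
    intro a c
    simp only [jac_quadMap x hsymm]
    exact (HasFDerivAt.fun_sum fun e _ => (hp e).const_mul (Γ c a e)).const_sub _
  have hJ0 : ∀ a c, jac n (quadMap x Γ) 0 a c = (1 : Matrix _ _ ℝ) a c := by
    intro a c
    simp [jac_quadMap x hsymm]
  have hid : fderiv ℝ (quadMap x Γ) 0 = ContinuousLinearMap.id ℝ (Pt n) := by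
    have : (Matrix.of (jac n (quadMap x Γ) 0)) = 1 := by ext a c; exact hJ0 a c
    rw [fderiv_eq_linMap, this]
    ext1 y
    simp [linMap_apply]
  have hg' : ∀ c d, HasFDerivAt (fun y => g (quadMap x Γ y) c d)
      (fderiv ℝ (fun y => g y c d) x) 0 := by
    intro c d
    have h1 : HasFDerivAt (fun y => g y c d) (fderiv ℝ (fun y => g y c d) x)
        (quadMap x Γ 0) := by
      rw [quadMap_zero]
      exact (((hg.1 c d).contDiffAt (hW.mem_nhds hx)).differentiableAt (by simp)).hasFDerivAt
    have h2 := ((contDiff_quadMap x Γ).differentiable (by simp) 0).hasFDerivAt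
    rw [hid] at h2
    exact h1.comp 0 h2
  have h := HasFDerivAt.fun_sum (u := Finset.univ) fun c _ => HasFDerivAt.fun_sum
    (u := Finset.univ) fun d _ => ((hJ a c).mul (hJ b d)).mul (hg' c d)
  refine h.fderiv.trans ?_
  refine ContinuousLinearMap.coe_injective (LinearMap.pi_ext' fun e => LinearMap.ext_ring ?_)
  have e1 := hg.sum_mul_christoffel hx b a e
  have e2 := hg.sum_mul_christoffel hx a b e
  have e3 : ∀ c d, fderiv ℝ (fun y => g y c d) x (Pi.single e 1) = pd n e (fun y => g y c d) x :=
    fun _ _ => rfl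
  have e4 : ∀ a c, (-∑ e, Γ c a e • (ContinuousLinearMap.proj e : Pt n →L[ℝ] ℝ)) (Pi.single e 1)
      = -Γ c a e := fun a c => by simp [Pi.single_apply]
  have e5 : ∀ c, g x c b = g x b c := fun c => (hg.2 x hx).1 c b
  have e6 := hg.pd_symm hW hx e a b
  rw [← hΓ] at e1 e2
  simp only [LinearMap.coe_comp, ContinuousLinearMap.coe_coe, Function.comp_apply,
    LinearMap.coe_single, _root_.sum_apply, _root_.add_apply, _root_.smul_apply, Pi.mul_apply,
    e3, e4, hJ0, quadMap_zero, Matrix.one_apply, smul_eq_mul]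
  simp [Finset.sum_add_distrib, mul_add, e5]
  linarith

namespace NaturalTensor

variable {n k : ℕ} {T : NaturalTensor n k}

lemma ScaleInvariant.eq_atConst (hT : T.ScaleInvariant) (hv : T.VanishesWithForm) (hk : 1 ≤ k)
    {W : Set (Pt n)} (hW : IsOpen W) {g : Pt n → Fin (n + 1) → Fin (n + 1) → ℝ}
    {w : Pt n → (Fin k → Fin (n + 1)) → ℝ} (hg : IsMetricOn n W g) (hw : IsFormOn n k W w)
    {x : Pt n} (hx : x ∈ W) : T.T W g w x = T.atConst (g x) (w x) := by
  set τ := quadMap x (christoffel n g x) with hτ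
  have hsmooth : ContDiff ℝ (⊤ : ℕ∞) τ := contDiff_quadMap _ _
  have hτ0 : τ 0 = x := quadMap_zero _ _
  have hJ0 : Matrix.of (jac n τ 0) = 1 := by
    ext a c
    simp [hτ, jac_quadMap x (hg.christoffel_symm hW hx)]
  obtain ⟨U, σf, h0, hd, hUW, hdet⟩ := exists_isDiffeoOn hsmooth (x := 0)
    (by rw [hJ0, Matrix.det_one]; exact isUnit_one) hW (by rwa [hτ0])
  have hg' := hg.mono hUW
  have hw' := hw.mono hUW
  have h1 := T.localize _ _ g w g w hd.open_tgt hW hUW hg' hw' hg hw (fun _ _ => ⟨rfl, rfl⟩) x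
    ⟨0, h0, hτ0⟩
  have hgU := IsMetricOn.pullTensor hsmooth hd.mapsTo hdet hg'
  have hwU := IsFormOn.pullForm hsmooth hd.mapsTo hw'
  funext a b
  have h2 := T.natural _ _ _ _ hd g w hg' hw' 0 h0 a b
  rw [hT.eq_atConst_of_fderiv_eq_zero hv hk hd.open_src h0 hgU hwU
    (hg.fderiv_pullTensor_quadMap hW hx), pullTensor_eq, pullTensor_eq, pullForm_eq, hJ0,
    pullB_one, pullB_one, pullF_one, hτ0, h1] at h2
  exact h2.symm

end NaturalTensor

end Paper

namespace Paper

/-- a natural tensor independent of the unit of scale that vanishes where the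
form vanishes is a linear combination of `⟨i_−ω,i_−ω⟩_g` and `⟨ω,ω⟩_g g`. -/
theorem statement4 (n k : ℕ) (hn : 1 ≤ n) (hk1 : 1 ≤ k) (hk2 : k ≤ n + 1)
    (T : NaturalTensor n k)
    (scale : ∀ W g ω, IsOpen W → IsMetricOn n W g → IsFormOn n k W ω →
      ∀ lam : ℝ, 0 < lam → ∀ x ∈ W, ∀ a b,
        T.T W (fun y c d => lam ^ 2 * g y c d) (fun y v => lam ^ (k - 1) * ω y v) x a b
          = T.T W g ω x a b)
    (vanish : ∀ W g ω, IsOpen W → IsMetricOn n W g → IsFormOn n k W ω →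
      ∀ x ∈ W, (∀ v, ω x v = 0) → ∀ a b, T.T W g ω x a b = 0) :
    ∃ μ₁ μ₂ : ℝ, ∀ W g ω, IsOpen W → IsMetricOn n W g → IsFormOn n k W ω →
      ∀ x ∈ W, ∀ a b,
        T.T W g ω x a b =
          μ₁ * iiInner n k g ω x a b + μ₂ * scalarSq n k g ω x * g x a b := by
  have hT : T.ScaleInvariant := scale
  obtain ⟨μ₁, μ₂, h⟩ := hT.exists_atConst_eq hk1 hk2
  refine ⟨μ₁, μ₂, fun W g ω hW hg hω x hx a b => ?_⟩
  rw [hT.eq_atConst vanish hk1 hW hg hω hx, iiInner_eq, scalarSq_eq]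
  exact h _ (hg.2 x hx) _ (hω.2 x hx) a b

end Paper
end

section
/- Fix n ≥ 1 and 1 ≤ k ≤ 1+n. For every k-form ω on V = ℝ^{1+n} and every observer U, the electric part E_U := U* ∧ i_U ω and the magnetic part B_U := i_U (U* ∧ ω) are orthogonal, ⟨E_U, B_U⟩ = 0, and consequently ⟨ω, ω⟩ = ⟨E_U, E_U⟩ + ⟨B_U, B_U⟩. -/
namespace Paper

noncomputable section

/-- The vector space `V = ℝ^{1+n}`. -/
abbrev V (n : ℕ) := Fin (n + 1) → ℝ

/-- The standard basis vectors `e₀, …, e_n`. -/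
def eb (n : ℕ) (i : Fin (n + 1)) : V n := Pi.single i 1

/-- The Minkowski bilinear form `η(x,y) = x₀y₀ − Σᵢ xᵢyᵢ`. -/
def mink (n : ℕ) (x y : V n) : ℝ := ∑ i, eps n i * x i * y i

/-- An observer: a unitary timelike vector oriented to the future. -/
def IsObserver (n : ℕ) (U : V n) : Prop := mink n U U = 1 ∧ 0 < mink n U (eb n 0)

open Classical in
/-- The induced scalar product of two (raw) `k`-forms:
`⟨ω, ω̄⟩ = Σ_{i₁ < ⋯ < i_k} ε_{i₁}⋯ε_{i_k} ω(e_{i₁},…,e_{i_k}) ω̄(e_{i₁},…,e_{i_k})`. -/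
def finner (n k : ℕ) (ω ω' : (Fin k → V n) → ℝ) : ℝ :=
  ∑ v ∈ Finset.univ.filter (fun v : Fin k → Fin (n + 1) => StrictMono v),
    (∏ j, eps n (v j)) * ω (fun j => eb n (v j)) * ω' (fun j => eb n (v j))

/-- Interior product `i_D ω = ω(D, −, …, −)` of a vector with a (raw) `k`-form. -/
def inter (n k : ℕ) (D : V n) (ω : (Fin k → V n) → ℝ) : (Fin (k - 1) → V n) → ℝ :=
  fun v => ω (fun j => if h : (j : ℕ) = 0 then D
    else v ⟨(j : ℕ) - 1, by have := j.isLt; omega⟩)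

/-- The metrically equivalent `1`-form `U* = η(U, −)`. -/
def ustar (n : ℕ) (U : V n) : V n → ℝ := fun w => mink n U w

/-- Wedge product of a `1`-form with a (raw) `k`-form:
`(α ∧ ω)(v₀,…,v_k) = Σ_j (−1)^j α(v_j) ω(v₀,…,v̂_j,…,v_k)`. -/
def wedge1 (n k : ℕ) (α : V n → ℝ) (ω : (Fin k → V n) → ℝ) : (Fin (k + 1) → V n) → ℝ :=
  fun v => ∑ j : Fin (k + 1), (-1 : ℝ) ^ (j : ℕ) * α (v j) * ω (v ∘ j.succAbove)

/-- The electric part `E_U = U* ∧ i_U ω` of a `k`-form with respect to an observer `U`. -/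
def EU (n k : ℕ) (U : V n) (ω : (Fin k → V n) → ℝ) : (Fin (k - 1 + 1) → V n) → ℝ :=
  wedge1 n (k - 1) (ustar n U) (inter n k U ω)

/-- The magnetic part `B_U = i_U (U* ∧ ω)` of a `k`-form with respect to an observer `U`. -/
def BU (n k : ℕ) (U : V n) (ω : (Fin k → V n) → ℝ) : (Fin k → V n) → ℝ :=
  inter n (k + 1) U (wedge1 n k (ustar n U) ω)

/-- Reindexing a raw form along an equality of degrees. -/
def reind (n : ℕ) {m m' : ℕ} (h : m = m') (ω : (Fin m → V n) → ℝ) : (Fin m' → V n) → ℝ :=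
  fun v => ω (fun j => v (Fin.cast h j))

/-- The energy tensor of a `k`-form:
`(−1)^{k−1} T(D₁,D₂) = ⟨i_{D₁}ω, i_{D₂}ω⟩ − (1/2)⟨ω,ω⟩ η(D₁,D₂)`. -/
def energyT (n k : ℕ) (ω : (Fin k → V n) → ℝ) (D₁ D₂ : V n) : ℝ :=
  (-1 : ℝ) ^ (k - 1) * (finner n (k - 1) (inter n k D₁ ω) (inter n k D₂ ω)
    - (1 / 2) * finner n k ω ω * mink n D₁ D₂)

/-- The volume form `dX`, with `dX(e₀,…,e_n) = 1`. -/
def dX (n : ℕ) (u : Fin (n + 1) → V n) : ℝ := Matrix.det (Matrix.of fun i j => u i j)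

/-- The Hodge star of a (raw) `k`-form:
`(*ω)(v₁,…,v_{1+n−k}) = (1/k!) Σ_{i₁,…,i_k} ε_{i₁}⋯ε_{i_k} ω(e_{i₁},…,e_{i_k})
  dX(e_{i₁},…,e_{i_k},v₁,…,v_{1+n−k})`. -/
def hodge (n k : ℕ) (ω : (Fin k → V n) → ℝ) : (Fin (n + 1 - k) → V n) → ℝ :=
  fun v => (1 / (k.factorial : ℝ)) * ∑ i : Fin k → Fin (n + 1),
    (∏ j, eps n (i j)) * ω (fun j => eb n (i j)) *
      dX n (fun l => if h : (l : ℕ) < k then eb n (i ⟨(l : ℕ), h⟩)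
        else v ⟨(l : ℕ) - k, by have := l.isLt; omega⟩)

/-- The bilinear form associated to a matrix `g`. -/
def gbil (n : ℕ) (g : Matrix (Fin (n + 1)) (Fin (n + 1)) ℝ) (x y : V n) : ℝ :=
  ∑ a, ∑ b, g a b * x a * y b

/-- The scalar product of two (raw) `k`-forms with respect to a metric `g` (indices raised
with the inverse matrix `g⁻¹`):
`⟨ω,ω̄⟩_g = (1/k!) Σ g^{i₁j₁}⋯g^{i_kj_k} ω_{i₁…i_k} ω̄_{j₁…j_k}`. -/
def ginner (n : ℕ) (g : Matrix (Fin (n + 1)) (Fin (n + 1)) ℝ) (k : ℕ)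
    (ω ω' : (Fin k → V n) → ℝ) : ℝ :=
  (1 / (k.factorial : ℝ)) * ∑ v : Fin k → Fin (n + 1), ∑ w : Fin k → Fin (n + 1),
    (∏ j, g⁻¹ (v j) (w j)) * ω (fun j => eb n (v j)) * ω' (fun j => eb n (w j))

/-- The energy tensor of a `k`-form with respect to a metric `g`:
`T(g,ω)(D₁,D₂) = (−1)^{k−1}( ⟨i_{D₁}ω, i_{D₂}ω⟩_g − (1/2)⟨ω,ω⟩_g g(D₁,D₂) )`. -/
def energyTg (n : ℕ) (g : Matrix (Fin (n + 1)) (Fin (n + 1)) ℝ) (k : ℕ)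
    (ω : (Fin k → V n) → ℝ) (D₁ D₂ : V n) : ℝ :=
  (-1 : ℝ) ^ (k - 1) * (ginner n g (k - 1) (inter n k D₁ ω) (inter n k D₂ ω)
    - (1 / 2) * ginner n g k ω ω * gbil n g D₁ D₂)

end

end Paper

namespace Paper

open Finset Fin

/-- A symmetric function of `k` indices vanishing on non-injective tuples sums to `k!` times its
sum over strictly increasing tuples. -/
theorem sum_eq_factorial_mul_sum_strictMono {k : ℕ} {ι : Type*} [LinearOrder ι] [Fintype ι]
    [DecidablePred fun v : Fin k → ι => StrictMono v] (f : (Fin k → ι) → ℝ)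
    (hf : ∀ (σ : Equiv.Perm (Fin k)) v, f (v ∘ σ) = f v)
    (hf₀ : ∀ v, ¬ Function.Injective v → f v = 0) :
    ∑ v, f v = (k.factorial : ℝ) * ∑ v with StrictMono v, f v := by
  classical
  have hinj : ∑ v, f v = ∑ v with Function.Injective v, f v := by
    rw [sum_filter]
    exact sum_congr rfl fun v _ => by split_ifs with h; exacts [rfl, hf₀ v h]
  have hbij : ∑ p ∈ (univ : Finset (Equiv.Perm (Fin k))) ×ˢ
        ({v | StrictMono v} : Finset (Fin k → ι)), f p.2 =
      ∑ v with Function.Injective v, f v := by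
    refine sum_bij (fun p _ => p.2 ∘ p.1) ?_ ?_ ?_ ?_
    · rintro ⟨σ, v⟩ h
      simp only [mem_product, mem_univ, mem_filter, true_and] at h ⊢
      exact h.injective.comp σ.injective
    · rintro ⟨σ, v⟩ h ⟨τ, w⟩ h' heq
      simp only [mem_product, mem_univ, mem_filter, true_and] at h h' heq
      have hr : v = w := by
        refine (h.range_inj h').1 ?_
        rw [← σ.surjective.range_comp v, heq, τ.surjective.range_comp w]
      subst hr
      have hσ : σ = τ := Equiv.ext fun i => h.injective (congrFun heq i)
      rw [hσ]
    · intro v h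
      simp only [mem_filter, mem_univ, true_and] at h
      refine ⟨((Tuple.sort v)⁻¹, v ∘ Tuple.sort v), ?_, ?_⟩
      · simp only [mem_product, mem_univ, mem_filter, true_and]
        exact (Tuple.monotone_sort v).strictMono_of_injective
          (h.comp (Tuple.sort v).injective)
      · ext i
        simp
    · rintro ⟨σ, v⟩ _
      exact (hf σ v).symm
  rw [hinj, ← hbij, sum_product]
  simp [Fintype.card_perm]

theorem sum_eps_mul_eq_factorial_mul_finner {n k : ℕ} (α β : V n [⋀^Fin k]→ₗ[ℝ] ℝ) :
    ∑ v : Fin k → Fin (n + 1),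
      (∏ j, eps n (v j)) * α (fun j => eb n (v j)) * β (fun j => eb n (v j)) =
    (k.factorial : ℝ) * finner n k α β := by
  classical
  rw [sum_eq_factorial_mul_sum_strictMono, finner]
  · intro σ v
    have hα : α (fun j => eb n ((v ∘ σ) j)) = _ := α.map_perm (fun j => eb n (v j)) σ
    have hβ : β (fun j => eb n ((v ∘ σ) j)) = _ := β.map_perm (fun j => eb n (v j)) σ
    have hε : ∏ j, eps n ((v ∘ σ) j) = ∏ j, eps n (v j) :=
      Equiv.prod_comp σ fun j => eps n (v j)
    rw [hα, hβ, hε]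
    rcases Int.units_eq_one_or (Equiv.Perm.sign σ) with h | h <;> simp [h]
  · intro v hv
    have hα : α (fun j => eb n (v j)) = 0 :=
      α.map_eq_zero_of_not_injective _ fun h => hv (Function.Injective.of_comp (f := eb n) h)
    rw [hα, mul_zero, zero_mul]

theorem eps_mul_eps (n : ℕ) (i : Fin (n + 1)) : eps n i * eps n i = 1 := by
  unfold eps; split_ifs <;> norm_num

theorem mink_eb (n : ℕ) (U : V n) (i : Fin (n + 1)) : mink n U (eb n i) = eps n i * U i := by
  simp [mink, eb, Pi.single_apply]

/-- The linear form `U* = η(U, −)`. -/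
noncomputable def lower (n : ℕ) (U : V n) : V n →ₗ[ℝ] ℝ where
  toFun := ustar n U
  map_add' x y := by simp [ustar, mink, mul_add, sum_add_distrib]
  map_smul' c x := by
    simp only [ustar, mink, Pi.smul_apply, smul_eq_mul, RingHom.id_apply, mul_sum]
    exact sum_congr rfl fun _ _ => by ring

theorem lower_apply (n : ℕ) (U w : V n) : lower n U w = mink n U w := rfl

/-- The wedge product of a linear form with an alternating form. -/
noncomputable def wedgeAlt {n k : ℕ} (α : V n →ₗ[ℝ] ℝ) (β : V n [⋀^Fin k]→ₗ[ℝ] ℝ) :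
    V n [⋀^Fin (k + 1)]→ₗ[ℝ] ℝ :=
  AlternatingMap.alternatizeUncurryFin (α.smulRight β)

theorem wedgeAlt_apply {n k : ℕ} (α : V n →ₗ[ℝ] ℝ) (β : V n [⋀^Fin k]→ₗ[ℝ] ℝ)
    (v : Fin (k + 1) → V n) :
    wedgeAlt α β v = ∑ j : Fin (k + 1), (-1 : ℝ) ^ (j : ℕ) * α (v j) * β (j.removeNth v) := by
  simp only [wedgeAlt, AlternatingMap.alternatizeUncurryFin_apply, LinearMap.smulRight_apply,
    AlternatingMap.smul_apply, smul_eq_mul, zsmul_eq_mul]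
  push_cast
  simp only [mul_assoc]

theorem coe_wedgeAlt_lower {n k : ℕ} (U : V n) (β : V n [⋀^Fin k]→ₗ[ℝ] ℝ) :
    ⇑(wedgeAlt (lower n U) β) = wedge1 n k (ustar n U) β :=
  funext (wedgeAlt_apply _ _)

theorem inter_succ {n k : ℕ} (D : V n) (f : (Fin (k + 1) → V n) → ℝ) (v : Fin k → V n) :
    inter n (k + 1) D f v = f (cons D v) := by
  refine congrArg f (funext fun j => ?_)
  cases j using Fin.cases <;> simp

theorem coe_curryLeft {n k : ℕ} (U : V n) (ω : V n [⋀^Fin (k + 1)]→ₗ[ℝ] ℝ) :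
    ⇑(ω.curryLeft U) = inter n (k + 1) U ω :=
  funext fun v => (inter_succ U ω v).symm

theorem EU_succ {n k : ℕ} (U : V n) (ω : V n [⋀^Fin (k + 1)]→ₗ[ℝ] ℝ) :
    EU n (k + 1) U ω = wedgeAlt (lower n U) (ω.curryLeft U) := by
  rw [coe_wedgeAlt_lower, coe_curryLeft]; rfl

/-- `i_U (U* ∧ ω) = η(U, U) ω − U* ∧ i_U ω`. -/
theorem wedgeAlt_lower_cons {n k : ℕ} (α : V n →ₗ[ℝ] ℝ) (U : V n)
    (ω : V n [⋀^Fin (k + 1)]→ₗ[ℝ] ℝ) (v : Fin (k + 1) → V n) :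
    wedgeAlt α ω (cons U v) = α U * ω v - wedgeAlt α (ω.curryLeft U) v := by
  rw [wedgeAlt_apply, wedgeAlt_apply, Fin.sum_univ_succ, sub_eq_add_neg, ← sum_neg_distrib]
  congr 1
  · simp
  · refine sum_congr rfl fun j _ => ?_
    have h : j.succ.removeNth (cons U v : Fin (k + 2) → V n) = cons U (j.removeNth v) :=
      cons_comp_succ_succAbove U v j
    rw [h, AlternatingMap.curryLeft_apply_apply, cons_succ, val_succ, pow_succ, Matrix.vecCons]
    ring

theorem BU_succ {n k : ℕ} {U : V n} (hU : mink n U U = 1) (ω : V n [⋀^Fin (k + 1)]→ₗ[ℝ] ℝ) :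
    BU n (k + 1) U ω = ⇑(ω - wedgeAlt (lower n U) (ω.curryLeft U)) := by
  funext v
  rw [BU, inter_succ, ← coe_wedgeAlt_lower, wedgeAlt_lower_cons, lower_apply, hU, one_mul,
    AlternatingMap.sub_apply]

theorem curryLeft_wedgeAlt_curryLeft {n k : ℕ} {U : V n} (hU : mink n U U = 1)
    (ω : V n [⋀^Fin (k + 1)]→ₗ[ℝ] ℝ) :
    (wedgeAlt (lower n U) (ω.curryLeft U)).curryLeft U = ω.curryLeft U := by
  ext v
  cases k with
  | zero =>
    simp only [AlternatingMap.curryLeft_apply_apply, wedgeAlt_apply]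
    simp [lower_apply, hU, Matrix.vecCons, Subsingleton.elim _ v]
  | succ k =>
    have h := wedgeAlt_lower_cons (lower n U) U (ω.curryLeft U) v
    rw [AlternatingMap.curryLeft_same, lower_apply, hU, one_mul] at h
    rw [AlternatingMap.curryLeft_apply_apply, Matrix.vecCons, h, wedgeAlt_apply]
    simp

theorem sum_smul_eb (n : ℕ) (U : V n) : ∑ i, U i • eb n i = U := by
  ext j
  simp [eb, Pi.single_apply]

/-- `U* ∧ −` is adjoint to `i_U`. -/
theorem finner_wedgeAlt_lower {n k : ℕ} (U : V n) (α : V n [⋀^Fin k]→ₗ[ℝ] ℝ)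
    (β : V n [⋀^Fin (k + 1)]→ₗ[ℝ] ℝ) :
    finner n (k + 1) (wedgeAlt (lower n U) α) β = finner n k α (β.curryLeft U) := by
  have hk : ((k + 1).factorial : ℝ) ≠ 0 := by positivity
  refine mul_left_cancel₀ hk ?_
  rw [← sum_eps_mul_eq_factorial_mul_finner, Nat.factorial_succ, Nat.cast_mul, mul_assoc,
    ← sum_eps_mul_eq_factorial_mul_finner]
  simp only [wedgeAlt_apply, mul_sum, sum_mul]
  rw [sum_comm]
  have hβ (w : Fin k → Fin (n + 1)) : β.curryLeft U (fun j => eb n (w j)) =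
      ∑ a, U a * β (Matrix.vecCons (eb n a) fun j => eb n (w j)) := by
    conv_lhs => rw [← sum_smul_eb n U]
    let L : V n →ₗ[ℝ] ℝ :=
      { toFun x := β.curryLeft x fun j => eb n (w j)
        map_add' x y := by rw [map_add, AlternatingMap.add_apply]
        map_smul' c x := by rw [map_smul, AlternatingMap.smul_apply, RingHom.id_apply] }
    exact (map_sum L _ _).trans (sum_congr rfl fun a _ => map_smul L _ _)
  have hterm (j : Fin (k + 1)) : ∑ v : Fin (k + 1) → Fin (n + 1),
      (∏ j, eps n (v j)) * ((-1 : ℝ) ^ (j : ℕ) * lower n U (eb n (v j)) *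
        α (j.removeNth fun j => eb n (v j))) * β (fun j => eb n (v j)) =
      ∑ w : Fin k → Fin (n + 1), (∏ j, eps n (w j)) * α (fun j => eb n (w j)) *
        β.curryLeft U (fun j => eb n (w j)) := by
    rw [← (insertNthEquiv (fun _ => Fin (n + 1)) j).sum_comp, Fintype.sum_prod_type, sum_comm]
    refine sum_congr rfl fun w _ => ?_
    rw [hβ, mul_sum]
    refine sum_congr rfl fun a _ => ?_
    have h₁ : (fun i => eb n ((j.insertNth a w : Fin (k + 1) → Fin (n + 1)) i)) =
        j.insertNth (eb n a) fun i => eb n (w i) := by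
      funext i
      cases i using j.succAboveCases <;> simp
    have h₂ : (-1 : ℝ) ^ (j : ℕ) * (-1 : ℝ) ^ (j : ℕ) = 1 := by
      rw [← mul_pow]; norm_num
    simp only [insertNthEquiv_apply, h₁, insertNth_apply_same, lower_apply, mink_eb,
      removeNth_insertNth, Fin.prod_univ_succAbove _ j, insertNth_apply_succAbove,
      AlternatingMap.map_insertNth, zsmul_eq_mul]
    push_cast
    linear_combination (∏ i, eps n (w i)) * α (fun i => eb n (w i)) * U a *
      β (Matrix.vecCons (eb n a) fun j => eb n (w j)) *
      ((-1 : ℝ) ^ (j : ℕ) * (-1 : ℝ) ^ (j : ℕ) * eps_mul_eps n a + h₂)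
  rw [sum_congr rfl fun j _ => hterm j]
  simp [mul_sum]

theorem finner_comm {n k : ℕ} (f g : (Fin k → V n) → ℝ) : finner n k f g = finner n k g f :=
  sum_congr rfl fun _ _ => by ring

theorem finner_add_left {n k : ℕ} (f g h : (Fin k → V n) → ℝ) :
    finner n k (f + g) h = finner n k f h + finner n k g h := by
  simp only [finner, Pi.add_apply, ← sum_add_distrib]
  exact sum_congr rfl fun _ _ => by ring

theorem finner_add_self {n k : ℕ} {f g : (Fin k → V n) → ℝ} (h : finner n k f g = 0) :
    finner n k (f + g) (f + g) = finner n k f f + finner n k g g := by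
  rw [finner_add_left, finner_comm f, finner_comm g, finner_add_left, finner_add_left,
    finner_comm g f, h]
  ring

/-- `⟨E_U, B_U⟩ = 0` and `⟨ω,ω⟩ = ⟨E_U,E_U⟩ + ⟨B_U,B_U⟩`. -/
theorem statement7 (n k : ℕ) (hn : 1 ≤ n) (hk1 : 1 ≤ k) (hk2 : k ≤ n + 1)
    (ω : AlternatingMap ℝ (V n) ℝ (Fin k)) (U : V n) (hU : IsObserver n U) :
    finner n k (reind n (by omega : k - 1 + 1 = k) (EU n k U ⇑ω)) (BU n k U ⇑ω) = 0 ∧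
    finner n k ⇑ω ⇑ω =
      finner n k (reind n (by omega : k - 1 + 1 = k) (EU n k U ⇑ω))
        (reind n (by omega : k - 1 + 1 = k) (EU n k U ⇑ω))
      + finner n k (BU n k U ⇑ω) (BU n k U ⇑ω) := by
  obtain ⟨m, rfl⟩ : ∃ m, k = m + 1 := ⟨k - 1, by omega⟩
  have hE : reind n (by omega : m + 1 - 1 + 1 = m + 1) (EU n (m + 1) U ⇑ω) =
      ⇑(wedgeAlt (lower n U) (ω.curryLeft U)) := by
    rw [← EU_succ]; rfl
  rw [hE, BU_succ hU.1]
  have horth : finner n (m + 1) (wedgeAlt (lower n U) (ω.curryLeft U))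
      ⇑(ω - wedgeAlt (lower n U) (ω.curryLeft U)) = 0 := by
    have hB : (ω - wedgeAlt (lower n U) (ω.curryLeft U)).curryLeft U = 0 := by
      ext v
      have h := DFunLike.congr_fun (curryLeft_wedgeAlt_curryLeft hU.1 ω) v
      simp only [AlternatingMap.curryLeft_apply_apply, AlternatingMap.sub_apply,
        AlternatingMap.zero_apply] at h ⊢
      rw [h, sub_self]
    rw [finner_wedgeAlt_lower, hB]
    simp [finner]
  refine ⟨horth, ?_⟩
  rw [← finner_add_self horth]
  congr 1 <;> · funext v; simp

end Paper
end
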